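/- arXiv:2009.02452 — 8 statements merged into one kernel-verified Lean document; each statement's English description precedes it below -/
import Mathlib

section
/- Let n ≥ 6 be a natural number. If M is an m × m matrix whose entries are polynomials of degree at most 1 in ℂ[x_1, ..., x_n] (affine functions) such that det(M) = ∑_{i=1}^n x_i^n as polynomials, then 2m ≥ 3n − 6 (equivalently, m ≥ 1.5n − 3). In particular, the determinantal complexity of the power sum polynomial ∑_{i=1}^n x_i^n over ℂ is at least 1.5n − 3. -/
open MvPolynomial

namespace MvPolynomial

theorem height_of_isMaximal {K : Type*} [Field K] {n : ℕ} (I : Ideal (MvPolynomial (Fin n) K))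
    [I.IsMaximal] : I.height = n := by
  induction n with
  | zero =>
    have h : I.height ≤ ringKrullDim (MvPolynomial (Fin 0) K) :=
      Ideal.height_le_ringKrullDim_of_ne_top Ideal.IsPrime.ne_top'
    rw [ringKrullDim_of_isNoetherianRing] at h
    simpa using h
  | succ n ih =>
    let e := (finSuccEquiv K n).toRingEquiv
    let J := I.map e
    have : J.IsMaximal := Ideal.map_isMaximal_of_equiv e
    have : (J.under (MvPolynomial (Fin n) K)).IsMaximal :=
      Polynomial.isMaximal_comap_C_of_isJacobsonRing J
    have : J.LiesOver (J.under (MvPolynomial (Fin n) K)) := ⟨rfl⟩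
    rw [← e.height_map I, Polynomial.height_eq_height_add_one (J.under (MvPolynomial (Fin n) K)) J,
      ih]
    simp

theorem totalDegree_det_le {R σ ι : Type*} [CommRing R] [Fintype ι] [DecidableEq ι]
    (M : Matrix ι ι (MvPolynomial σ R)) (hM : ∀ i j, (M i j).totalDegree ≤ 1) :
    M.det.totalDegree ≤ Fintype.card ι := by
  rw [Matrix.det_apply]
  refine totalDegree_finsetSum_le fun s _ => ?_
  refine (totalDegree_smul_le _ _).trans ((totalDegree_finsetProd _ _).trans ?_)
  simpa using Finset.sum_le_card_nsmul Finset.univ _ 1 fun i _ => hM (s i) i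

theorem totalDegree_pderiv_le {R σ : Type*} [CommSemiring R] (i : σ) (p : MvPolynomial σ R) :
    (pderiv i p).totalDegree ≤ p.totalDegree - 1 := by
  classical
  conv_lhs => rw [p.as_sum]
  rw [map_sum]
  refine totalDegree_finsetSum_le fun s hs => ?_
  rw [pderiv_monomial]
  by_cases hi : s i = 0
  · simp [hi]
  · refine (totalDegree_monomial_le _ _).trans ?_
    have hle := le_totalDegree hs
    have hs' : s = (s - Finsupp.single i 1) + Finsupp.single i 1 := by
      rw [tsub_add_cancel_of_le]
      simpa using Nat.one_le_iff_ne_zero.mpr hi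
    have hsum : (s.sum fun _ e => e) = ((s - Finsupp.single i 1).sum fun _ e => e) + 1 := by
      conv_lhs => rw [hs', Finsupp.sum_add_index' (by simp) (by simp)]
      simp
    change ((s - Finsupp.single i 1).sum fun _ e => e) ≤ _
    omega

/-- A prime modulo which each variable satisfies an equation `X i ^ k = f i` with `f i` of
lower degree is maximal. -/
theorem isMaximal_of_pow_sub_mem {K : Type*} [Field K] {σ : Type*} [Finite σ] {k : ℕ}
    (Q : Ideal (MvPolynomial σ K)) [Q.IsPrime] (f : σ → MvPolynomial σ K)
    (hf : ∀ i, (f i).totalDegree < k) (hQ : ∀ i, X i ^ k - f i ∈ Q) : Q.IsMaximal := by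
  classical
  have := Fintype.ofFinite σ
  let S : Set (σ →₀ ℕ) := {s | ∀ i, s i < k}
  have hS : S.Finite := by
    refine (Set.finite_Iic (Finsupp.equivFunOnFinite.symm fun _ : σ => k)).subset fun s hs => ?_
    exact fun i => (hs i).le
  let g : (σ →₀ ℕ) → MvPolynomial σ K ⧸ Q := fun s => Ideal.Quotient.mk Q (monomial s 1)
  let W := Submodule.span K (g '' S)
  have key (d : ℕ) (p : MvPolynomial σ K) (hp : p.totalDegree ≤ d) :
      Ideal.Quotient.mk Q p ∈ W := by
    induction d using Nat.strong_induction_on generalizing p with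
    | _ d ih =>
      rw [p.as_sum, map_sum]
      refine Submodule.sum_mem _ fun s hs => ?_
      have hsd := (le_totalDegree hs).trans hp
      rw [← mul_one (coeff s p), ← smul_eq_mul, ← smul_monomial]
      change coeff s p • g s ∈ W
      refine W.smul_mem (coeff s p) ?_
      by_cases hsS : s ∈ S
      · exact Submodule.subset_span ⟨s, hsS, rfl⟩
      · obtain ⟨i, hi⟩ : ∃ i, k ≤ s i := by simpa [S] using hsS
        have hs' : s = Finsupp.single i k + (s - Finsupp.single i k) := by
          rw [add_tsub_cancel_of_le]
          simpa using hi
        have hsum : (s.sum fun _ e => e) = k + ((s - Finsupp.single i k).sum fun _ e => e) := by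
          conv_lhs => rw [hs', Finsupp.sum_add_index' (by simp) (by simp)]
          simp
        have hmk : Ideal.Quotient.mk Q (monomial s 1) =
            Ideal.Quotient.mk Q (f i * monomial (s - Finsupp.single i k) 1) := by
          rw [hs', ← one_mul (1 : K), ← monomial_mul, ← X_pow_eq_monomial, ← hs', map_mul, map_mul,
            Ideal.Quotient.eq.mpr (hQ i), one_mul]
        change Ideal.Quotient.mk Q (monomial s 1) ∈ W
        rw [hmk]
        have hk := hf i
        refine ih (d - 1) (by omega) _ ((totalDegree_mul _ _).trans ?_)
        have := totalDegree_monomial_le (s - Finsupp.single i k) (1 : K)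
        change _ ≤ ((s - Finsupp.single i k).sum fun _ e => e) at this
        omega
  have hW : W = ⊤ := by
    refine Submodule.eq_top_iff'.mpr fun x => ?_
    obtain ⟨p, rfl⟩ := Ideal.Quotient.mk_surjective x
    exact key _ p le_rfl
  have : Module.Finite K (MvPolynomial σ K ⧸ Q) :=
    ⟨hW ▸ Submodule.fg_span (hS.image g)⟩
  exact Ideal.Quotient.maximal_of_isField _ (isField_of_isIntegral_of_isField' (Field.toIsField K))

end MvPolynomial

theorem Derivation.apply_mem_of_mem_sq {R A : Type*} [CommRing R] [CommRing A] [Algebra R A]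
    (D : Derivation R A A) {I : Ideal A} {a : A} (ha : a ∈ I ^ 2) : D a ∈ I := by
  rw [pow_two] at ha
  induction ha using Submodule.mul_induction_on' with
  | mem_mul_mem x hx y hy =>
    rw [D.leibniz]
    exact add_mem (I.mul_mem_right _ hx) (I.mul_mem_right _ hy)
  | add x _ y _ hx hy => simpa using add_mem hx hy

namespace Matrix

variable {R ι κ : Type*} [CommRing R] [Fintype ι] [DecidableEq ι] [Fintype κ] [DecidableEq κ]

/-- The Schur complement of the upper left block, multiplied by the determinant of that block. -/
def scaledSchur (M : Matrix (ι ⊕ κ) (ι ⊕ κ) R) : Matrix κ κ R :=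
  M.toBlocks₁₁.det • M.toBlocks₂₂ - M.toBlocks₂₁ * M.toBlocks₁₁.adjugate * M.toBlocks₁₂

theorem det_mul_pow_eq_det_mul_det_scaledSchur (M : Matrix (ι ⊕ κ) (ι ⊕ κ) R) :
    M.det * M.toBlocks₁₁.det ^ Fintype.card κ = M.toBlocks₁₁.det * M.scaledSchur.det := by
  have h : M * fromBlocks 1 (-(M.toBlocks₁₁.adjugate * M.toBlocks₁₂)) 0
      (M.toBlocks₁₁.det • (1 : Matrix κ κ R)) =
      fromBlocks M.toBlocks₁₁ 0 M.toBlocks₂₁ M.scaledSchur := by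
    nth_rw 1 [← fromBlocks_toBlocks M]
    rw [fromBlocks_multiply]
    congr 1
    · simp
    · rw [Matrix.mul_neg, ← Matrix.mul_assoc, mul_adjugate]
      simp
    · simp
    · simp [scaledSchur, Matrix.mul_assoc, sub_eq_neg_add]
  have := congrArg det h
  rwa [det_mul, det_fromBlocks_zero₂₁, det_one, one_mul, det_smul, det_one, mul_one,
    det_fromBlocks_zero₁₂] at this

variable {Q : Ideal R}

theorem det_mem_sq_of_rows_mem {M : Matrix ι ι R} {i j : ι} (hij : i ≠ j)
    (hi : ∀ k, M i k ∈ Q) (hj : ∀ k, M j k ∈ Q) : M.det ∈ Q ^ 2 := by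
  rw [← det_transpose, det_apply]
  refine Submodule.sum_mem _ fun s _ => ?_
  rw [Units.smul_def, zsmul_eq_mul]
  refine Ideal.mul_mem_left _ _ ?_
  rw [← Finset.mul_prod_erase _ _ (Finset.mem_univ i),
    ← Finset.mul_prod_erase _ _ (Finset.mem_erase.mpr ⟨hij.symm, Finset.mem_univ j⟩), ← mul_assoc,
    pow_two]
  exact Ideal.mul_mem_right _ _ (Ideal.mul_mem_mul (hi _) (hj _))

theorem exists_notMem_mul_det_sub_mem_sq [Q.IsPrime] {γ : R}
    {M : Matrix (ι ⊕ Unit ⊕ κ) (ι ⊕ Unit ⊕ κ) R} (hM : M.toBlocks₁₁.det ∉ Q) (hγ : γ ∉ Q)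
    (hcorner : M.scaledSchur (.inl ()) (.inl ()) ∈ Q)
    (hrow : ∀ k, M.scaledSchur (.inl ()) (.inr k) ∈ Q)
    (hcol : ∀ k, M.scaledSchur (.inr k) (.inl ()) ∈ Q)
    (hblock : M.scaledSchur.toBlocks₂₂.det - γ * M.toBlocks₁₁.det ^ Fintype.card κ ∈ Q) :
    ∃ e ∉ Q, e * (M.det -
      γ * (M.submatrix (Sum.map id Sum.inl : ι ⊕ Unit → _) (Sum.map id Sum.inl)).det) ∈ Q ^ 2 ∧
      (M.submatrix (Sum.map id Sum.inl : ι ⊕ Unit → _) (Sum.map id Sum.inl)).det ∈ Q := by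
  set N := M.submatrix (Sum.map id Sum.inl : ι ⊕ Unit → _) (Sum.map id Sum.inl)
  set δ := M.toBlocks₁₁.det
  set S := M.scaledSchur
  set d := S.toBlocks₂₂.det
  set a := S (.inl ()) (.inl ())
  have hd : d ∉ Q := by
    intro h
    rw [sub_mem_comm_iff, Submodule.sub_mem_iff_left _ h] at hblock
    exact (Ideal.IsPrime.mem_or_mem ‹_› hblock).elim hγ
      fun h => hM (Ideal.IsPrime.mem_of_pow_mem ‹_› _ h)
  have hMdet : M.det * δ ^ (Fintype.card κ + 1) = δ * S.det := by
    simpa [add_comm] using det_mul_pow_eq_det_mul_det_scaledSchur M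
  have hNdet : N.det * δ = δ * a := by
    have := det_mul_pow_eq_det_mul_det_scaledSchur N
    rwa [Fintype.card_unit, pow_one, det_unique N.scaledSchur] at this
  let T := S.submatrix (Equiv.sumComm κ Unit) (Equiv.sumComm κ Unit)
  let r := (T.toBlocks₂₁ * T.toBlocks₁₁.adjugate * T.toBlocks₁₂) () ()
  have hSdet : S.det * d = d * (d * a - r) := by
    have := det_mul_pow_eq_det_mul_det_scaledSchur T
    rwa [Fintype.card_unit, pow_one, det_unique T.scaledSchur, det_submatrix_equiv_self] at this
  have hr : r ∈ Q ^ 2 := by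
    change ∑ k, (∑ l, S (.inl ()) (.inr l) * _) * S (.inr k) (.inl ()) ∈ Q ^ 2
    rw [pow_two]
    exact Submodule.sum_mem _ fun k _ => Ideal.mul_mem_mul
      (Submodule.sum_mem _ fun l _ => Ideal.mul_mem_right _ _ (hrow l)) (hcol k)
  refine ⟨d * δ ^ (Fintype.card κ + 1), ?_, ?_, ?_⟩
  · intro h
    exact (Ideal.IsPrime.mem_or_mem ‹_› h).elim hd
      fun h => hM (Ideal.IsPrime.mem_of_pow_mem ‹_› _ h)
  · have : d * δ ^ (Fintype.card κ + 1) * (M.det - γ * N.det) =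
        δ * d * (a * (d - γ * δ ^ Fintype.card κ)) - δ * d * r := by
      linear_combination d * hMdet + δ * hSdet - d * δ ^ Fintype.card κ * γ * hNdet
    rw [this]
    refine sub_mem (Ideal.mul_mem_left _ _ ?_) (Ideal.mul_mem_left _ _ hr)
    rw [pow_two]
    exact Ideal.mul_mem_mul hcorner hblock
  · refine (Ideal.IsPrime.mem_or_mem ‹_› ?_).resolve_right hM
    rw [hNdet]
    exact Q.mul_mem_left _ hcorner

theorem exists_det_eq_and_map_eval_eq_diagonal {K σ : Type*} [Field K]
    (M : Matrix ι ι (MvPolynomial σ K)) (hM : ∀ i j, (M i j).totalDegree ≤ 1) (y : σ → K) :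
    ∃ (M' : Matrix ι ι (MvPolynomial σ K)) (D : ι → K), M'.det = M.det ∧
      (∀ i j, (M' i j).totalDegree ≤ 1) ∧ M'.map (eval y) = diagonal D := by
  obtain ⟨L, L', D, h⟩ :=
    Pivot.exists_list_transvec_mul_mul_list_transvec_eq_diagonal (M.map (eval y))
  set A := (L.map TransvectionStruct.toMatrix).prod with hA
  set B := (L'.map TransvectionStruct.toMatrix).prod with hB
  refine ⟨A.map C * M * B.map C, D, ?_, fun i j => ?_, ?_⟩
  · have hdet (E : Matrix ι ι K) : (E.map (C : K →+* MvPolynomial σ K)).det = C E.det :=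
      (RingHom.map_det C E).symm
    rw [det_mul, det_mul, hdet, hdet, hA, hB, TransvectionStruct.det_toMatrix_prod,
      TransvectionStruct.det_toMatrix_prod]
    simp
  · simp only [mul_apply, map_apply]
    refine totalDegree_finsetSum_le fun k _ => (totalDegree_mul _ _).trans ?_
    rw [totalDegree_C, add_zero]
    refine totalDegree_finsetSum_le fun l _ => (totalDegree_mul _ _).trans ?_
    rw [totalDegree_C, zero_add]
    exact hM l k
  · rw [← h, Matrix.map_mul, Matrix.map_mul]
    congr <;> ext <;> simp

end Matrix

theorem Derivation.apply_mem_of_mul_mem_sq {R A : Type*} [CommRing R] [CommRing A] [Algebra R A]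
    (D : Derivation R A A) {I : Ideal A} [I.IsPrime] {e a : A} (he : e ∉ I)
    (h : e * a ∈ I ^ 2) : D a ∈ I := by
  have ha : a ∈ I := (Ideal.IsPrime.mem_or_mem ‹_› (Ideal.pow_le_self two_ne_zero h)).resolve_left he
  have hD := D.apply_mem_of_mem_sq h
  rw [D.leibniz, smul_eq_mul, smul_eq_mul, Submodule.add_mem_iff_left _ (I.mul_mem_right _ ha)] at hD
  exact (Ideal.IsPrime.mem_or_mem ‹_› hD).resolve_left he

namespace MvPolynomial

theorem pderiv_sum_X_pow {R σ : Type*} [CommSemiring R] [Fintype σ] (k : ℕ) (i : σ) :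
    pderiv i (∑ j : σ, (X j : MvPolynomial σ R) ^ k) = C (k : R) * X i ^ (k - 1) := by
  classical
  rw [map_sum, Finset.sum_eq_single i]
  · simp [Derivation.leibniz_pow]
  · intro j _ hj
    simp [Derivation.leibniz_pow, pderiv_X_of_ne hj]
  · simp

theorem le_totalDegree_sum_X_pow {R σ : Type*} [CommSemiring R] [Nontrivial R] [Fintype σ]
    [Nonempty σ] {k : ℕ} (hk : k ≠ 0) :
    k ≤ (∑ j : σ, (X j : MvPolynomial σ R) ^ k).totalDegree := by
  classical
  obtain ⟨i⟩ := ‹Nonempty σ›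
  have h : Finsupp.single i k ∈ (∑ j : σ, (X j : MvPolynomial σ R) ^ k).support := by
    rw [mem_support_iff, coeff_sum, Finset.sum_eq_single i]
    · simp [coeff_X_pow]
    · intro j _ hj
      rw [coeff_X_pow, if_neg]
      rw [Finsupp.single_left_inj hk]
      exact hj
    · simp
  simpa using le_totalDegree h

end MvPolynomial

theorem exists_ne_zero_sum_pow_eq_zero {K : Type*} [Field K] [IsAlgClosed K] {n k : ℕ}
    (hn : 2 ≤ n) (hk : k ≠ 0) : ∃ y : Fin n → K, y ≠ 0 ∧ ∑ i, y i ^ k = 0 := by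
  obtain ⟨n, rfl⟩ := Nat.exists_eq_add_of_le' hn
  obtain ⟨z, hz⟩ := IsAlgClosed.exists_pow_nat_eq (-1 : K) (Nat.pos_of_ne_zero hk)
  refine ⟨Fin.cons 1 (Fin.cons z 0), fun h => one_ne_zero (congrFun h 0), ?_⟩
  simp [Fin.sum_univ_succ, hz, hk]

/-- At a zero of `det M` where the gradient does not vanish, `M` can be assumed to be diagonal with
a single zero entry, in a prescribed position. -/
theorem Matrix.exists_reindex_map_eval_eq_diagonal {K σ ι κ : Type*} [Field K] [Fintype ι]
    [DecidableEq ι] [Fintype κ] [DecidableEq κ] (M : Matrix ι ι (MvPolynomial σ K))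
    (hM : ∀ i j, (M i j).totalDegree ≤ 1) {y : σ → K} (hy : eval y M.det = 0) {i : σ}
    (hi : eval y (pderiv i M.det) ≠ 0) (e : κ ≃ ι) (k₀ : κ) :
    ∃ (N : Matrix κ κ (MvPolynomial σ K)) (D : κ → K), N.det = M.det ∧
      (∀ i j, (N i j).totalDegree ≤ 1) ∧ N.map (eval y) = diagonal D ∧ D k₀ = 0 ∧
      ∀ k ≠ k₀, D k ≠ 0 := by
  obtain ⟨M', D, hdet, hdeg, hD⟩ := exists_det_eq_and_map_eval_eq_diagonal M hM y
  obtain ⟨i₀, hi₀⟩ : ∃ i₀, D i₀ = 0 := by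
    have : (diagonal D).det = 0 := by
      rw [← hD, ← hy, ← hdet, RingHom.map_det]
      rfl
    rw [det_diagonal, Finset.prod_eq_zero_iff] at this
    simpa using this
  have hne (j : ι) (hj : j ≠ i₀) : D j ≠ 0 := by
    intro hj₀
    have hrow (l : ι) (hl : D l = 0) (k : ι) : M' l k ∈ RingHom.ker (eval y) := by
      rw [RingHom.mem_ker, ← map_apply (f := eval y), hD, diagonal_apply, hl, ite_self]
    have := (pderiv i).apply_mem_of_mem_sq (det_mem_sq_of_rows_mem hj (hrow j hj₀) (hrow i₀ hi₀))
    rw [hdet] at this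
    exact hi this
  let e' := e.trans (Equiv.swap (e k₀) i₀)
  have he' : e' k₀ = i₀ := by simp [e']
  refine ⟨M'.submatrix e' e', D ∘ e', ?_, fun _ _ => hdeg _ _, ?_, ?_, fun k hk => hne _ ?_⟩
  · rw [det_submatrix_equiv_self, hdet]
  · rw [← submatrix_map, hD, submatrix_diagonal_equiv]
  · simp [he', hi₀]
  · rw [← he']
    exact e'.injective.ne hk

/-- For `n ≥ 6`, if `M` is an `m × m` matrix whose entries are
polynomials of degree at most 1 in `ℂ[x_1, …, x_n]` with `det M = ∑_{i=1}^n x_i^n`,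
then `2m ≥ 3n - 6`; in particular the determinantal complexity of the power sum
polynomial `∑ x_i^n` over `ℂ` is at least `1.5 n - 3`. -/
theorem dc_power_sum_lower_bound (n m : ℕ) (hn : 6 ≤ n)
    (M : Matrix (Fin m) (Fin m) (MvPolynomial (Fin n) ℂ))
    (hdeg : ∀ i j, (M i j).totalDegree ≤ 1)
    (hdet : M.det = ∑ i : Fin n, X i ^ n) :
    2 * m ≥ 3 * n - 6 := by
  by_contra hlt
  have hnm : n ≤ m := by
    have : Nonempty (Fin n) := ⟨⟨0, by omega⟩⟩
    have := totalDegree_det_le M hdeg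
    rw [Fintype.card_fin, hdet] at this
    exact (le_totalDegree_sum_X_pow (by omega)).trans this
  obtain ⟨y, hy, hsum⟩ : ∃ y : Fin n → ℂ, y ≠ 0 ∧ ∑ i, y i ^ n = 0 :=
    exists_ne_zero_sum_pow_eq_zero (by omega) (by omega)
  obtain ⟨i, hi⟩ := Function.ne_iff.mp hy
  have hn0 : (n : ℂ) ≠ 0 := by
    rw [Nat.cast_ne_zero]
    omega
  let κ := Fin (m - n + 1)
  have e : Fin (n - 2) ⊕ Unit ⊕ κ ≃ Fin m := Fintype.equivOfCardEq (by simp [κ]; omega)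
  obtain ⟨N, D, hN, hNdeg, hND, hD0, hDne⟩ := M.exists_reindex_map_eval_eq_diagonal hdeg
    (y := y) (by simp [hdet, hsum]) (i := i) (by
      rw [hdet, pderiv_sum_X_pow]
      simpa [hn0] using fun h => absurd h hi) e (.inr (.inl ()))
  let I := RingHom.ker (eval y)
  have hI : I.IsMaximal := RingHom.ker_isMaximal_of_surjective _ fun c => ⟨C c, eval_C c⟩
  let γ : ℂ := ∏ k : κ, D (.inr (.inr k))
  have hγ : γ ≠ 0 := Finset.prod_ne_zero_iff.mpr fun k _ => hDne _ (by simp)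
  let S := N.scaledSchur
  let δ := N.toBlocks₁₁.det
  let g : Bool ⊕ κ ⊕ κ → MvPolynomial (Fin n) ℂ := Sum.elim
    (fun b => cond b (S (.inl ()) (.inl ()))
      (S.toBlocks₂₂.det - C γ * δ ^ Fintype.card κ))
    (Sum.elim (fun k => S (.inl ()) (.inr k)) fun k => S (.inr k) (.inl ()))
  have hNy (a b) : eval y (N a b) = Matrix.diagonal D a b := by rw [← hND, Matrix.map_apply]
  have hδ : eval y δ = ∏ l, D (.inl l) := by
    rw [RingHom.map_det, ← Matrix.det_diagonal]
    congr 1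
    ext a b
    simp [Matrix.toBlocks₁₁, hNy, Matrix.diagonal_apply]
  have hδ0 : eval y δ ≠ 0 := by
    rw [hδ]
    exact Finset.prod_ne_zero_iff.mpr fun k _ => hDne _ (by simp)
  have hS (a b) : eval y (S a b) = (eval y δ • Matrix.diagonal fun k => D (.inr k)) a b := by
    simp [S, Matrix.scaledSchur, Matrix.mul_apply, Matrix.toBlocks₂₁, Matrix.toBlocks₁₂,
      Matrix.toBlocks₂₂, hNy, Matrix.diagonal_apply, δ]
  have hgI (x) : g x ∈ I := by
    rw [RingHom.mem_ker]
    obtain (_ | _) | k | k := x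
    · have : (eval y).mapMatrix S.toBlocks₂₂ =
          eval y δ • Matrix.diagonal fun k => D (.inr (.inr k)) := by
        ext a b
        simp [Matrix.toBlocks₂₂, hS, Matrix.diagonal_apply]
      simp [g, RingHom.map_det, this, Matrix.det_diagonal, γ, mul_comm]
    · simp [g, hS, hD0]
    · simp [g, hS]
    · simp [g, hS]
  classical
  obtain ⟨Q, hQmin, hQI⟩ := Ideal.exists_minimalPrimes_le
    (I := Ideal.span (Finset.univ.image g : Set (MvPolynomial (Fin n) ℂ))) (J := I) (by
      rw [Ideal.span_le]
      simpa [Set.range_subset_iff] using hgI)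
  have hQ : Q.IsPrime := hQmin.1.1
  have hgQ (x) : g x ∈ Q := hQmin.1.2 (Ideal.subset_span (by simp))
  have hheight : Q.height ≤ (2 * (m - n + 2) : ℕ) := by
    refine (Ideal.height_le_card_of_mem_minimalPrimes_span_finset hQmin).trans ?_
    refine Nat.cast_le.mpr (Finset.card_image_le.trans ?_)
    simp [κ]
    omega
  obtain ⟨c, hcQ, hc, -⟩ := Matrix.exists_notMem_mul_det_sub_mem_sq (Q := Q) (γ := C γ) (M := N)
    (fun h => hδ0 (hQI h)) (fun h => hγ (by simpa [I, RingHom.mem_ker] using hQI h))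
    (hgQ (.inl true)) (fun k => hgQ (.inr (.inl k))) (fun k => hgQ (.inr (.inr k)))
    (hgQ (.inl false))
  set Δ := (N.submatrix (Sum.map id Sum.inl : Fin (n - 2) ⊕ Unit → _) (Sum.map id Sum.inl)).det
  have hΔ : Δ.totalDegree ≤ n - 1 := by
    refine (totalDegree_det_le _ fun _ _ => hNdeg _ _).trans ?_
    simp
    omega
  have hmax : Q.IsMaximal := by
    refine isMaximal_of_pow_sub_mem (k := n - 1) Q (fun i => C ((n : ℂ)⁻¹ * γ) * pderiv i Δ)
      (fun i => ?_) fun i => ?_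
    · have h₁ := totalDegree_mul (C ((n : ℂ)⁻¹ * γ)) (pderiv i Δ)
      have h₂ := totalDegree_pderiv_le i Δ
      rw [totalDegree_C] at h₁
      omega
    · have h := Q.mul_mem_left (C (n : ℂ)⁻¹) ((pderiv i).apply_mem_of_mul_mem_sq hcQ hc)
      rw [hN, hdet, map_sub, pderiv_sum_X_pow, pderiv_C_mul, mul_sub, ← mul_assoc,
        ← mul_assoc, ← C_mul, ← C_mul, inv_mul_cancel₀ hn0, C_1, one_mul] at h
      exact h
  rw [height_of_isMaximal Q, Nat.cast_le] at hheight
  omega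
end

section
/- Let d ≥ 2 be a natural number and let P_1, ..., P_t, Q_1, ..., Q_t, P' ∈ ℂ[x_1, ..., x_n] be polynomials such that deg(P') < d, there exists a point a ∈ ℂ^n with P_j(a) = 0 and Q_j(a) = 0 for all j ∈ {1, ..., t} (a common zero), and ∑_{i=1}^n x_i^d = ∑_{j=1}^t P_j · Q_j + P'. Then 2t ≥ n. -/
open MvPolynomial

/-- Maximal ideals of a polynomial ring in `n` variables over a field have height `n`. -/
theorem MvPolynomial.height_eq_of_isMaximal {K : Type*} [Field K] (n : ℕ)
    (p : Ideal (MvPolynomial (Fin n) K)) [p.IsMaximal] : p.height = n := by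
  induction n with
  | zero =>
    have h := Ideal.height_le_ringKrullDim_of_ne_top (I := p) Ideal.IsPrime.ne_top'
    rw [MvPolynomial.ringKrullDim_of_isNoetherianRing] at h
    simpa using h
  | succ n ih =>
    let e := (finSuccEquiv K n).toRingEquiv
    have : (p.map e).IsMaximal := Ideal.map_isMaximal_of_equiv e
    rw [← e.height_map p]
    generalize p.map e = q at this
    have : (q.under (MvPolynomial (Fin n) K)).IsMaximal :=
      Polynomial.isMaximal_comap_C_of_isJacobsonRing q
    rw [Polynomial.height_eq_height_add_one (q.under (MvPolynomial (Fin n) K)) q, ih]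
    simp

/-- If every `X i ^ e` is congruent modulo `J` to a polynomial of degree less than `e`, then the
quotient by `J` is spanned by the monomials whose exponents are all less than `e`. -/
theorem MvPolynomial.finite_quotient_of_X_pow_sub_mem {σ K : Type*} [Finite σ] [CommRing K]
    (J : Ideal (MvPolynomial σ K)) (e : ℕ)
    (h : ∀ i, ∃ g : MvPolynomial σ K, g.totalDegree < e ∧ X i ^ e - g ∈ J) :
    Module.Finite K (MvPolynomial σ K ⧸ J) := by
  classical
  let S : Set (σ →₀ ℕ) := {m | ∀ i, m i < e}
  have hS : S.Finite := by
    have hf : (Set.univ.pi fun _ : σ ↦ Set.Iio e).Finite :=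
      Set.Finite.pi fun _ ↦ Set.finite_Iio e
    refine (hf.preimage (DFunLike.coe_injective (F := σ →₀ ℕ)).injOn).subset fun m hm ↦ ?_
    simpa [S] using hm
  let φ := Ideal.Quotient.mkₐ K J
  let V : Submodule K (MvPolynomial σ K ⧸ J) :=
    Submodule.span K ((fun m ↦ φ (monomial m 1)) '' S)
  have key (N : ℕ) (f : MvPolynomial σ K) (hf : f.totalDegree < N) : φ f ∈ V := by
    induction N generalizing f with
    | zero => omega
    | succ N ih =>
      rw [f.as_sum, map_sum]
      refine Submodule.sum_mem _ fun m hm ↦ ?_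
      have hmN : m.degree < N + 1 := (le_totalDegree hm).trans_lt hf
      rw [← mul_one (f.coeff m), ← smul_eq_mul, ← smul_monomial, map_smul]
      refine V.smul_mem _ ?_
      by_cases hmS : m ∈ S
      · exact Submodule.subset_span ⟨m, hmS, rfl⟩
      obtain ⟨i, hi⟩ : ∃ i, e ≤ m i := by simpa [S] using hmS
      obtain ⟨g, hg, hgJ⟩ := h i
      obtain ⟨m', rfl⟩ : ∃ m', m = m' + Finsupp.single i e :=
        ⟨m - Finsupp.single i e, (tsub_add_cancel_of_le (by simpa using hi)).symm⟩
      have hφ : φ (X i ^ e) = φ g := Ideal.Quotient.eq.2 hgJ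
      rw [monomial_add_single, map_mul, hφ, ← map_mul]
      refine ih _ ?_
      have h1 : (monomial m' (1 : K)).totalDegree ≤ m'.degree := totalDegree_monomial_le m' 1
      have h2 := totalDegree_mul (monomial m' (1 : K)) g
      simp only [map_add, Finsupp.degree_single] at hmN
      omega
  have hV : V = ⊤ := by
    refine eq_top_iff.2 fun x _ ↦ ?_
    obtain ⟨f, rfl⟩ := Ideal.Quotient.mkₐ_surjective K J x
    exact key _ f (Nat.lt_succ_self _)
  exact ⟨hV ▸ Submodule.fg_span (hS.image _)⟩

theorem MvPolynomial.totalDegree_pderiv_lt {σ R : Type*} [CommSemiring R] {f : MvPolynomial σ R}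
    {d : ℕ} (hd : 0 < d) (hf : f.totalDegree < d + 1) (i : σ) :
    (pderiv i f).totalDegree < d := by
  refine (Finset.sup_lt_iff hd).2 fun m hm ↦ ?_
  have hm' : m + Finsupp.single i 1 ∈ f.support := by
    rw [mem_support_iff, coeff_pderiv] at hm
    exact mem_support_iff.2 (left_ne_zero_of_mul hm)
  have h : (m + Finsupp.single i 1).degree < d + 1 := (le_totalDegree hm').trans_lt hf
  rw [map_add, Finsupp.degree_single] at h
  exact Nat.lt_of_succ_lt_succ h

/-- If `∑ i, X i ^ d = ∑ j, P j * Q j + P'`, then modulo any ideal containing all `P j` and `Q j`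
the power `X i ^ (d - 1)` is congruent to a multiple of the `i`-th partial derivative of `P'`. -/
theorem MvPolynomial.X_pow_sub_pderiv_mem {σ ι K : Type*} [Fintype σ] [Fintype ι] [Field K]
    [CharZero K] {d : ℕ} (hd : d ≠ 0) {P Q : ι → MvPolynomial σ K} {P' : MvPolynomial σ K}
    (heq : (∑ i, X i ^ d) = ∑ j, P j * Q j + P') {J : Ideal (MvPolynomial σ K)}
    (hP : ∀ j, P j ∈ J) (hQ : ∀ j, Q j ∈ J) (i : σ) :
    X i ^ (d - 1) - (d : K)⁻¹ • pderiv i P' ∈ J := by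
  classical
  have hsum : pderiv i (∑ k, X k ^ d : MvPolynomial σ K) = (d : K) • X i ^ (d - 1) := by
    simp [pderiv_X, Pi.single_apply, smul_eq_C_mul]
  have hdiff : (d : K) • X i ^ (d - 1) - pderiv i P' = ∑ j, pderiv i (P j * Q j) := by
    rw [← hsum, heq, map_add, map_sum, add_sub_cancel_right]
  have hmem : (d : K) • X i ^ (d - 1) - pderiv i P' ∈ J := by
    rw [hdiff]
    refine J.sum_mem fun j _ ↦ ?_
    rw [pderiv_mul]
    exact J.add_mem (J.mul_mem_left _ (hQ j)) (J.mul_mem_right _ (hP j))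
  have h := Submodule.smul_of_tower_mem J (d : K)⁻¹ hmem
  rwa [smul_sub, inv_smul_smul₀ (Nat.cast_ne_zero.2 hd)] at h

/-- Lemma of [CKSV19, K19]. If `∑_{i=1}^n x_i^d = ∑_{j=1}^t P_j Q_j + P'`
where `deg P' < d`, `d ≥ 2`, and the `P_j`'s and `Q_j`'s have a common zero, then `2t ≥ n`. -/
theorem width_lower_bound (n d t : ℕ) (hd : 2 ≤ d)
    (P Q : Fin t → MvPolynomial (Fin n) ℂ) (P' : MvPolynomial (Fin n) ℂ)
    (hP' : P'.totalDegree < d)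
    (hzero : ∃ a : Fin n → ℂ, ∀ j, eval a (P j) = 0 ∧ eval a (Q j) = 0)
    (heq : (∑ i : Fin n, X i ^ d) = ∑ j : Fin t, P j * Q j + P') :
    2 * t ≥ n := by
  obtain ⟨a, ha⟩ := hzero
  let s : Set (MvPolynomial (Fin n) ℂ) := Set.range (Sum.elim P Q)
  have hs : s.ncard ≤ 2 * t := by
    have h := Set.ncard_image_le (f := Sum.elim P Q) Set.finite_univ
    rw [Set.image_univ, Set.ncard_univ, Nat.card_eq_fintype_card] at h
    simpa [s, two_mul] using h
  have hne : Ideal.span s ≠ ⊤ := by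
    have hle : Ideal.span s ≤ RingHom.ker (eval a) := by
      rw [Ideal.span_le]
      rintro _ ⟨j | j, rfl⟩
      exacts [(ha j).1, (ha j).2]
    exact ne_top_of_le_ne_top (RingHom.ker_ne_top _) hle
  obtain ⟨p, hp⟩ := Ideal.nonempty_minimalPrimes hne
  have hsp : s ⊆ p := Ideal.span_le.1 hp.1.2
  have : p.IsPrime := hp.1.1
  have : Module.Finite ℂ (MvPolynomial (Fin n) ℂ ⧸ p) := by
    refine finite_quotient_of_X_pow_sub_mem p (d - 1) fun i ↦ ⟨_, ?_,
      X_pow_sub_pderiv_mem (by omega) heq (fun j ↦ hsp ⟨Sum.inl j, rfl⟩)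
        (fun j ↦ hsp ⟨Sum.inr j, rfl⟩) i⟩
    exact (totalDegree_smul_le _ _).trans_lt
      (totalDegree_pderiv_lt (by omega) (by omega) i)
  have : IsArtinianRing (MvPolynomial (Fin n) ℂ ⧸ p) := IsArtinianRing.of_finite ℂ _
  have : p.IsMaximal :=
    Ideal.Quotient.maximal_of_isField p (IsArtinianRing.isField_of_isDomain _)
  have hle := Ideal.height_le_card_of_mem_minimalPrimes_span (Set.finite_range _) hp
  rw [MvPolynomial.height_eq_of_isMaximal, Nat.cast_le] at hle
  exact hle.trans hs
end

section
/- Let d ≥ 2 and n ≥ 5 be natural numbers, and let M be an m × m matrix of polynomials in ℂ[x_1, ..., x_n] such that det(M) = ∑_{i=1}^n x_i^d as polynomials. Then there exists an m × m matrix M̃ of polynomials in ℂ[x_1, ..., x_n] with max degree of its entries at most the max degree of the entries of M, such that det(M̃) = ∑_{i=1}^n x_i^d, and the constant part M̃(0) is a diagonal m × m matrix with (M̃(0))_{1,1} = 0 and (M̃(0))_{i,i} = 1 for all 2 ≤ i ≤ m. -/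
namespace Matrix

theorem mul_mul_mem_of_forall_mem {ι R : Type*} [Fintype ι] [CommRing R] {I : Ideal R}
    (A B C : Matrix ι ι R)
    (h : ∀ i j, B i j ∈ I) (i j : ι) : (A * B * C) i j ∈ I := by
  simp only [mul_apply]
  exact I.sum_mem fun k _ => I.mul_mem_right _ (I.sum_mem fun l _ => I.mul_mem_left _ (h l k))

theorem updateRow_fromBlocks_inr {ι κ R : Type*} [DecidableEq ι] [DecidableEq κ]
    (A : Matrix ι ι R) (B : Matrix ι κ R) (C : Matrix κ ι R) (D : Matrix κ κ R) (j : κ)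
    (u : ι → R) (v : κ → R) :
    (fromBlocks A B C D).updateRow (Sum.inr j) (Sum.elim u v) =
      fromBlocks A B (C.updateRow j u) (D.updateRow j v) := by
  ext (a | a) (b | b) <;> simp [updateRow_apply]

section AdjugateIdeal

variable {ι κ R : Type*} [Fintype ι] [DecidableEq ι] [Fintype κ] [DecidableEq κ] [CommRing R]

/-- The ideal generated by the submaximal minors of a square matrix. -/
def adjugateIdeal (N : Matrix ι ι R) : Ideal R :=
  Ideal.span (Set.range fun p : ι × ι => N.adjugate p.1 p.2)

theorem adjugateIdeal_le_iff {N : Matrix ι ι R} {I : Ideal R} :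
    N.adjugateIdeal ≤ I ↔ ∀ i j, N.adjugate i j ∈ I := by
  simp only [adjugateIdeal, Ideal.span_le, Set.range_subset_iff, Prod.forall, SetLike.mem_coe]

theorem adjugate_mem_adjugateIdeal (N : Matrix ι ι R) (i j : ι) :
    N.adjugate i j ∈ N.adjugateIdeal :=
  adjugateIdeal_le_iff.1 le_rfl i j

theorem adjugateIdeal_mul_mul_le_iff {Q : Ideal R} [Q.IsPrime] (L N K : Matrix ι ι R)
    (hL : L.det ∉ Q) (hK : K.det ∉ Q) :
    (L * N * K).adjugateIdeal ≤ Q ↔ N.adjugateIdeal ≤ Q := by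
  simp only [adjugateIdeal_le_iff]
  have key : (L * N * K).adjugate = K.adjugate * N.adjugate * L.adjugate := by
    rw [adjugate_mul_distrib, adjugate_mul_distrib, mul_assoc]
  constructor
  · intro h i j
    have h' := mul_mul_mem_of_forall_mem K _ L h i j
    have : K * (L * N * K).adjugate * L = (K.det * L.det) • N.adjugate := by
      rw [key, ← mul_assoc, ← mul_assoc, mul_adjugate, mul_assoc, adjugate_mul]
      simp [smul_smul, mul_comm]
    rw [this, smul_apply, smul_eq_mul] at h'
    rcases Ideal.IsPrime.mem_or_mem ‹_› h' with h' | h'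
    · rcases Ideal.IsPrime.mem_or_mem ‹_› h' with h' | h'
      · exact absurd h' hK
      · exact absurd h' hL
    · exact h'
  · intro h i j
    rw [key]
    exact mul_mul_mem_of_forall_mem _ _ _ h i j

theorem adjugateIdeal_submatrix_equiv_self_le_iff {I : Ideal R} (N : Matrix ι ι R) (e : κ ≃ ι) :
    (N.submatrix e e).adjugateIdeal ≤ I ↔ N.adjugateIdeal ≤ I := by
  simp only [adjugateIdeal_le_iff, adjugate_submatrix_equiv_self, submatrix_apply,
    e.forall_congr_left]
  simp

theorem adjugateIdeal_submatrix_equiv_le_iff {Q : Ideal R} [hQ : Q.IsPrime] (N : Matrix ι ι R)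
    (e f : κ ≃ ι) : (N.submatrix e f).adjugateIdeal ≤ Q ↔ N.adjugateIdeal ≤ Q := by
  have h : N.submatrix e f =
      1 * N.submatrix e e * Equiv.Perm.permMatrix R (f.trans e.symm).symm := by
    rw [one_mul]
    ext i j
    simp [Equiv.Perm.permMatrix, PEquiv.mul_toMatrix_toPEquiv]
  rw [h, adjugateIdeal_mul_mul_le_iff, adjugateIdeal_submatrix_equiv_self_le_iff]
  · simpa using hQ.one_notMem
  · rw [det_permutation]
    intro h
    rcases Int.units_eq_one_or (Equiv.Perm.sign (f.trans e.symm).symm) with h' | h' <;>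
      rw [h'] at h <;> simp [hQ.one_notMem] at h

theorem det_mem_adjugateIdeal [Nonempty ι] (N : Matrix ι ι R) : N.det ∈ N.adjugateIdeal := by
  inhabit ι
  rw [det_eq_sum_mul_adjugate_row N default]
  exact Ideal.sum_mem _ fun j _ => Ideal.mul_mem_left _ _ (adjugate_mem_adjugateIdeal _ _ _)

theorem adjugateIdeal_fromBlocks_le_iff [Nonempty κ] {Q : Ideal R} [Q.IsPrime] {a : R}
    (ha : a ∉ Q) (N : Matrix κ κ R) :
    (fromBlocks (a • (1 : Matrix Unit Unit R)) 0 0 N).adjugateIdeal ≤ Q ↔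
      N.adjugateIdeal ≤ Q := by
  have hrr (i j : κ) : (fromBlocks (a • (1 : Matrix Unit Unit R)) 0 0 N).adjugate
      (Sum.inr i) (Sum.inr j) = a * N.adjugate i j := by
    rw [adjugate_apply, ← Sum.elim_zero_single, updateRow_fromBlocks_inr, det_fromBlocks_zero₁₂,
      adjugate_apply]
    simp
  have hlr (j : κ) : (fromBlocks (a • (1 : Matrix Unit Unit R)) 0 0 N).adjugate
      (Sum.inl ()) (Sum.inr j) = 0 := by
    rw [adjugate_apply, ← Sum.elim_single_zero, updateRow_fromBlocks_inr, det_fromBlocks_zero₁₂,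
      det_eq_zero_of_row_eq_zero (A := N.updateRow j 0) j (by simp), mul_zero]
  have hrl (j : κ) : (fromBlocks (a • (1 : Matrix Unit Unit R)) 0 0 N).adjugate
      (Sum.inr j) (Sum.inl ()) = 0 := by
    rw [← transpose_apply (adjugate _), adjugate_transpose, fromBlocks_transpose, adjugate_apply,
      ← Sum.elim_single_zero, transpose_zero, transpose_zero, updateRow_fromBlocks_inr,
      det_fromBlocks_zero₁₂,
      det_eq_zero_of_row_eq_zero (A := Nᵀ.updateRow j 0) j (by simp), mul_zero]
  have hll : (fromBlocks (a • (1 : Matrix Unit Unit R)) 0 0 N).adjugate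
      (Sum.inl ()) (Sum.inl ()) = N.det := by
    have : (fromBlocks (a • (1 : Matrix Unit Unit R)) 0 0 N).updateRow (Sum.inl ())
        (Pi.single (Sum.inl ()) 1) = fromBlocks 1 0 0 N := by
      ext (a | a) (b | b) <;> simp [updateRow_apply]
    rw [adjugate_apply, this, det_fromBlocks_zero₁₂]
    simp
  constructor
  · intro h
    rw [adjugateIdeal_le_iff] at h ⊢
    intro i j
    have := h (Sum.inr i) (Sum.inr j)
    rw [hrr] at this
    exact (Ideal.IsPrime.mem_or_mem ‹_› this).resolve_left ha
  · intro h
    rw [adjugateIdeal_le_iff]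
    rintro (⟨⟩ | i) (⟨⟩ | j)
    · rw [hll]; exact h (det_mem_adjugateIdeal N)
    · rw [hlr]; exact Q.zero_mem
    · rw [hrl]; exact Q.zero_mem
    · rw [hrr]; exact Q.mul_mem_left _ (h (adjugate_mem_adjugateIdeal N i j))

/-- Pivoting on an entry outside a prime: the Schur complement, with denominators cleared,
has the same degeneracy locus away from that entry. -/
theorem exists_adjugateIdeal_le_iff_of_notMem {k : ℕ} [NeZero k]
    (N : Matrix (Fin (k + 1)) (Fin (k + 1)) R) (i j : Fin (k + 1)) :
    ∃ N' : Matrix (Fin k) (Fin k) R, ∀ Q : Ideal R, Q.IsPrime → N i j ∉ Q →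
      (N.adjugateIdeal ≤ Q ↔ N'.adjugateIdeal ≤ Q) := by
  have hequiv (i : Fin (k + 1)) : ∃ e : Unit ⊕ Fin k ≃ Fin (k + 1), e (Sum.inl ()) = i := by
    obtain ⟨e⟩ : Nonempty (Unit ⊕ Fin k ≃ Fin (k + 1)) :=
      Fintype.card_eq.1 (by simp [add_comm])
    exact ⟨e.trans (Equiv.swap (e (Sum.inl ())) i), by simp⟩
  obtain ⟨e, he⟩ := hequiv i
  obtain ⟨f, hf⟩ := hequiv j
  set a := N i j
  set B := N.submatrix e f with hB
  have hB0 : B.toBlocks₁₁ = a • 1 := by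
    ext ⟨⟩ ⟨⟩
    simp [toBlocks₁₁, hB, he, hf, a]
  refine ⟨a • (a • B.toBlocks₂₂ - B.toBlocks₂₁ * B.toBlocks₁₂), fun Q hQ ha => ?_⟩
  rw [← adjugateIdeal_submatrix_equiv_le_iff N e f, ← hB,
    ← adjugateIdeal_fromBlocks_le_iff ha (a • (a • B.toBlocks₂₂ - B.toBlocks₂₁ * B.toBlocks₁₂)),
    ← adjugateIdeal_mul_mul_le_iff
      (fromBlocks 1 0 (-B.toBlocks₂₁) (a • (1 : Matrix (Fin k) (Fin k) R))) B
      (fromBlocks 1 (-B.toBlocks₁₂) 0 (a • (1 : Matrix (Fin k) (Fin k) R)))]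
  · rw [← fromBlocks_toBlocks B, hB0, fromBlocks_multiply, fromBlocks_multiply]
    simp [sub_eq_add_neg, add_comm]
  · rw [det_fromBlocks_zero₁₂]
    simpa using fun h => ha (hQ.mem_of_pow_mem _ h)
  · rw [det_fromBlocks_zero₂₁]
    simpa using fun h => ha (hQ.mem_of_pow_mem _ h)

theorem derivation_det_mem_adjugateIdeal {S : Type*} [CommRing S] [Algebra S R]
    (D : Derivation S R R) (N : Matrix ι ι R) : D N.det ∈ N.adjugateIdeal := by
  have hprod (s : Finset ι) (f : ι → R) :
      D (∏ i ∈ s, f i) = ∑ i ∈ s, D (f i) * ∏ j ∈ s.erase i, f j := by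
    induction s using Finset.induction_on with
    | empty => simp
    | insert a s ha ih =>
      rw [Finset.prod_insert ha, D.leibniz, ih, Finset.sum_insert ha, Finset.erase_insert ha,
        smul_eq_mul, smul_eq_mul, Finset.mul_sum, add_comm, mul_comm]
      congr 1
      refine Finset.sum_congr rfl fun i hi => ?_
      have hia : a ≠ i := fun h => ha (h ▸ hi)
      rw [Finset.erase_insert_of_ne hia, Finset.prod_insert (by simp [ha])]
      ring
  have hdet : D N.det = ∑ i, (N.updateCol i fun r => D (N r i)).det := by
    simp only [det_apply, map_sum]
    rw [Finset.sum_comm]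
    refine Finset.sum_congr rfl fun σ _ => ?_
    rw [← Finset.smul_sum, Units.smul_def, Units.smul_def, map_zsmul, hprod]
    congr 1
    refine Finset.sum_congr rfl fun i _ => ?_
    rw [← Finset.mul_prod_erase _ _ (Finset.mem_univ i), updateCol_self]
    congr 1
    refine Finset.prod_congr rfl fun j hj => ?_
    rw [updateCol_ne (Finset.ne_of_mem_erase hj)]
  rw [hdet]
  refine Ideal.sum_mem _ fun i _ => ?_
  rw [← cramer_apply, cramer_eq_adjugate_mulVec]
  exact Ideal.sum_mem _ fun j _ => Ideal.mul_mem_right _ _ (adjugate_mem_adjugateIdeal N i j)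

theorem adjugate_mem_of_row_mem {I : Ideal R} (N : Matrix ι ι R) {r i j : ι} (hrj : r ≠ j)
    (h : ∀ c, N r c ∈ I) : N.adjugate i j ∈ I := by
  rw [adjugate_apply, ← Ideal.Quotient.eq_zero_iff_mem, RingHom.map_det]
  refine det_eq_zero_of_row_eq_zero r fun c => ?_
  simp [updateRow_ne hrj, Ideal.Quotient.eq_zero_iff_mem, h]

end AdjugateIdeal

end Matrix

open Polynomial in
/-- The variable `X` together with the constants in `P` generate the preimage of `P` under
evaluation at zero. -/
theorem Polynomial.map_C_sup_span_X_eq_comap {R : Type*} [CommRing R] (P : Ideal R) :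
    P.map C ⊔ Ideal.span {X} = P.comap (constantCoeff : R[X] →+* R) := by
  apply le_antisymm
  · refine sup_le (Ideal.map_le_iff_le_comap.2 fun x hx => ?_) ?_
    · simpa using hx
    · rw [Ideal.span_singleton_le_iff_mem]
      simp
  · intro f hf
    rw [← divX_mul_X_add f, add_comm]
    refine Submodule.add_mem_sup (Ideal.mem_map_of_mem C hf) ?_
    exact Ideal.mul_mem_left _ _ (Ideal.mem_span_singleton_self X)

theorem Ideal.mem_minimalPrimes_of_forall_le_iff {R : Type*} [CommRing R] {I J P : Ideal R}
    (h : ∀ Q : Ideal R, Q.IsPrime → Q ≤ P → (I ≤ Q ↔ J ≤ Q)) (hP : P ∈ I.minimalPrimes) :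
    P ∈ J.minimalPrimes :=
  ⟨⟨hP.1.1, (h P hP.1.1 le_rfl).1 hP.1.2⟩,
    fun Q hQ hQP => hP.2 ⟨hQ.1, (h Q hQ.1 hQP).2 hQ.2⟩ hQP⟩

theorem Ideal.height_le_height_map_C {R : Type*} [CommRing R] [IsNoetherianRing R]
    (P : Ideal R) [P.IsPrime] : P.height ≤ (P.map (Polynomial.C : R →+* Polynomial R)).height := by
  have : (P.map (Polynomial.C : R →+* Polynomial R)).LiesOver P := by
    refine ⟨?_⟩
    ext x
    simp only [Ideal.under_def, Ideal.mem_comap, Polynomial.algebraMap_eq, Ideal.mem_map_C_iff]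
    refine ⟨fun h n => ?_, fun h => by simpa using h 0⟩
    rw [Polynomial.coeff_C]
    split_ifs
    exacts [h, P.zero_mem]
  rw [Ideal.height_eq_height_add_of_liesOver_of_hasGoingDown P (P.map Polynomial.C)]
  exact le_self_add

open Polynomial in
/-- Perturbing the corner entry by a variable keeps the extension of a minimal prime minimal. -/
theorem Matrix.map_C_mem_minimalPrimes_adjugateIdeal {R : Type*} [CommRing R]
    [IsNoetherianRing R] {k : ℕ} (hk : 2 ≤ k) (N : Matrix (Fin (k + 1)) (Fin (k + 1)) R)
    {P : Ideal R} (hP : P ∈ N.adjugateIdeal.minimalPrimes) (hN : ∀ i j, N i j ∈ P) :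
    P.map C ∈ (N.map C + single 0 0 (X : R[X])).adjugateIdeal.minimalPrimes := by
  have := hP.1.1
  set N' := N.map C + single 0 0 (X : R[X]) with hN'
  have hmap : N'.map constantCoeff = N := by
    ext i j
    simp only [hN', map_apply, add_apply, single_apply, map_add]
    split_ifs <;> simp
  have hadj (i j) : constantCoeff (N'.adjugate i j) = N.adjugate i j := by
    have := congrFun₂ (RingHom.map_adjugate (constantCoeff : R[X] →+* R) N') i j
    simpa [RingHom.mapMatrix_apply, hmap] using this
  have hprime : (P.map C ⊔ Ideal.span {X}).IsPrime := by
    rw [map_C_sup_span_X_eq_comap]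
    infer_instance
  have hle : N'.adjugateIdeal ≤ P.map C := by
    rw [adjugateIdeal_le_iff]
    intro i j
    obtain ⟨r, hr0, hrj⟩ : ∃ r : Fin (k + 1), r ≠ 0 ∧ r ≠ j := by
      obtain ⟨r, hr⟩ := Finset.exists_mem_notMem_of_card_lt_card
        (s := {0, j}) (t := (Finset.univ : Finset (Fin (k + 1))))
        (Finset.card_le_two.trans_lt (by simp; omega))
      exact ⟨r, by simpa [not_or] using hr.2⟩
    refine adjugate_mem_of_row_mem N' hrj fun c => ?_
    simpa [hN', single_apply, hr0.symm] using Ideal.mem_map_of_mem C (hN r c)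
  have hlt : P.map C < P.map C ⊔ Ideal.span {X} := by
    refine left_lt_sup.2 fun h => ?_
    have h1 := Ideal.mem_map_C_iff.1 (h (Ideal.mem_span_singleton_self X)) 1
    rw [coeff_X_one] at h1
    exact hP.1.1.one_notMem h1
  refine Ideal.mem_minimalPrimes_span_of_mem_minimalPrimes_span_insert hlt X
    (Set.range fun p : Fin (k + 1) × Fin (k + 1) => N'.adjugate p.1 p.2) ?_ _
    (Ideal.span_le.1 hle)
    ((Set.subset_insert _ _).trans (Ideal.subset_span.trans Ideal.le_radical))
  rw [Ideal.span_insert, sup_comm]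
  refine ⟨⟨hprime, sup_le_sup_right hle _⟩, fun Q hQ hQP => ?_⟩
  have hQ' := hQ.1
  have hX : (X : R[X]) ∈ Q := hQ.2 (Ideal.mem_sup_right (Ideal.mem_span_singleton_self X))
  refine sup_le ?_ ((Ideal.span_singleton_le_iff_mem _).2 hX)
  rw [Ideal.map_le_iff_le_comap]
  refine hP.2 ⟨inferInstance, ?_⟩ ?_
  · rw [adjugateIdeal_le_iff]
    intro i j
    have h1 : N'.adjugate i j ∈ Q :=
      hQ.2 (Ideal.mem_sup_left (adjugate_mem_adjugateIdeal N' i j))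
    rw [← divX_mul_X_add (N'.adjugate i j), Ideal.add_mem_iff_right _ (Q.mul_mem_left _ hX)] at h1
    rw [Ideal.mem_comap, ← hadj]
    exact h1
  · intro x hx
    have h1 := hQP hx
    rw [map_C_sup_span_X_eq_comap] at h1
    simpa using h1

open Polynomial in
/-- Minimal primes over the ideal of submaximal minors have height at most four. -/
theorem Matrix.height_le_four_of_mem_minimalPrimes_adjugateIdeal {k : ℕ} :
    ∀ {R : Type*} [CommRing R] [IsNoetherianRing R] (N : Matrix (Fin k) (Fin k) R)
      {P : Ideal R}, P ∈ N.adjugateIdeal.minimalPrimes → P.height ≤ 4 := by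
  induction k with
  | zero =>
    intro R _ _ N P hP
    refine (Ideal.height_le_card_of_mem_minimalPrimes_span (Set.finite_range _) hP).trans ?_
    rw [Set.range_eq_empty]
    simp
  | succ k ih =>
    intro R _ _ N P hP
    rcases lt_or_ge k 2 with hk | hk
    · refine (Ideal.height_le_card_of_mem_minimalPrimes_span (Set.finite_range _) hP).trans ?_
      have h1 : (Set.range fun p : Fin (k + 1) × Fin (k + 1) => N.adjugate p.1 p.2).ncard ≤ 4 := by
        rw [← Set.image_univ]
        refine (Set.ncard_image_le Set.finite_univ).trans ?_
        rw [Set.ncard_univ, Nat.card_eq_fintype_card, Fintype.card_prod, Fintype.card_fin]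
        nlinarith
      exact_mod_cast h1
    · have : NeZero k := ⟨by omega⟩
      have pivot {S : Type _} [CommRing S] [IsNoetherianRing S]
          (A : Matrix (Fin (k + 1)) (Fin (k + 1)) S) {Q : Ideal S}
          (hQ : Q ∈ A.adjugateIdeal.minimalPrimes) (i j : Fin (k + 1)) (hij : A i j ∉ Q) :
          Q.height ≤ 4 := by
        obtain ⟨A', hA'⟩ := exists_adjugateIdeal_le_iff_of_notMem A i j
        exact ih A' (Ideal.mem_minimalPrimes_of_forall_le_iff
          (fun Q' hQ' hle => hA' Q' hQ' fun h => hij (hle h)) hQ)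
      by_cases hN : ∀ i j, N i j ∈ P
      · have := hP.1.1
        refine P.height_le_height_map_C.trans
          (pivot _ (map_C_mem_minimalPrimes_adjugateIdeal hk N hP hN) 0 0 fun h => ?_)
        have h1 := Ideal.mem_map_C_iff.1 h 1
        simp only [map_apply, add_apply, single_apply_same, coeff_add, coeff_X_one,
          coeff_C_of_ne_zero one_ne_zero, zero_add] at h1
        exact hP.1.1.one_notMem h1
      · push Not at hN
        obtain ⟨i, j, hij⟩ := hN
        exact pivot N hP i j hij

open MvPolynomial

/-- The ideal of the origin in affine `n`-space has height at least `n`. -/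
theorem MvPolynomial.le_height_ker_eval_zero (K : Type*) [Field K] (n : ℕ) :
    (n : ℕ∞) ≤ (RingHom.ker (eval (0 : Fin n → K))).height := by
  let φ (k : ℕ) : MvPolynomial (Fin n) K →ₐ[K] MvPolynomial (Fin n) K :=
    aeval fun i => if i.val < k then 0 else X i
  have hφ (k l : ℕ) (hkl : k ≤ l) : (φ l).comp (φ k) = φ l := by
    ext i : 1
    simp only [φ, AlgHom.comp_apply, aeval_X]
    split_ifs with h1 h2
    · simp
    · omega
    · simp_all
    · simp_all
  have hker (k l : ℕ) (hkl : k ≤ l) : RingHom.ker (φ k) ≤ RingHom.ker (φ l) := by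
    intro f hf
    rw [RingHom.mem_ker] at hf ⊢
    rw [← hφ k l hkl, AlgHom.comp_apply, hf, map_zero]
  have hprime (k : ℕ) : (RingHom.ker (φ k)).IsPrime := RingHom.ker_isPrime _
  have key (k : ℕ) (hk : k ≤ n) : (k : ℕ∞) ≤ (RingHom.ker (φ k)).height := by
    induction k with
    | zero => simp
    | succ k ih =>
      have hlt : RingHom.ker (φ k) < RingHom.ker (φ (k + 1)) := by
        refine lt_of_le_not_ge (hker _ _ k.le_succ) fun h => ?_
        have h1 : X ⟨k, hk⟩ ∈ RingHom.ker (φ (k + 1)) := by simp [RingHom.mem_ker, φ]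
        have h2 := h h1
        simp [RingHom.mem_ker, φ, X_ne_zero] at h2
      have := Ideal.height_add_one_le_of_lt_of_isPrime hlt
      push_cast
      exact (add_le_add_left (ih (by omega)) 1).trans this
  refine (key n le_rfl).trans (Ideal.height_mono fun f hf => ?_)
  rw [RingHom.mem_ker] at hf ⊢
  have hcomp : (aeval (0 : Fin n → K)).comp (φ n) = aeval (0 : Fin n → K) := by
    ext i
    simp [φ]
  have h0 := congrArg (aeval (0 : Fin n → K)) hf
  rwa [← AlgHom.comp_apply, hcomp, map_zero, aeval_eq_eval] at h0

/-- A determinantal representation of a sum of at least five powers has corank at most one at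
the origin. -/
theorem adjugate_map_eval_zero_ne_zero {n d m : ℕ} (hd : 2 ≤ d) (hn : 5 ≤ n)
    (M : Matrix (Fin m) (Fin m) (MvPolynomial (Fin n) ℂ))
    (hdet : M.det = ∑ i : Fin n, X i ^ d) :
    (M.map (eval (0 : Fin n → ℂ))).adjugate ≠ 0 := by
  intro h
  have hle : M.adjugateIdeal ≤ RingHom.ker (eval (0 : Fin n → ℂ)) := by
    rw [Matrix.adjugateIdeal_le_iff]
    intro i j
    have h1 := congrFun₂ (RingHom.map_adjugate (eval (0 : Fin n → ℂ)) M) i j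
    rw [RingHom.mapMatrix_apply, RingHom.mapMatrix_apply, h] at h1
    exact h1
  have : (RingHom.ker (eval (0 : Fin n → ℂ))).IsPrime := RingHom.ker_isPrime _
  obtain ⟨P, hP, hPle⟩ := Ideal.exists_minimalPrimes_le hle
  have hPprime := hP.1.1
  have hX (i : Fin n) : X i ∈ P := by
    have h1 := hP.1.2 (Matrix.derivation_det_mem_adjugateIdeal (pderiv (R := ℂ) i) M)
    have h2 : pderiv i M.det = C (d : ℂ) * X i ^ (d - 1) := by
      rw [hdet, map_sum, Finset.sum_eq_single i]
      · simp [Derivation.leibniz_pow]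
      · intro j _ hj
        simp [Derivation.leibniz_pow, pderiv_X_of_ne hj]
      · simp
    rw [h2] at h1
    have hunit : IsUnit (C (d : ℂ) : MvPolynomial (Fin n) ℂ) :=
      (IsUnit.mk0 (d : ℂ) (by simp; omega)).map C
    exact hPprime.mem_of_pow_mem _ ((Ideal.unit_mul_mem_iff_mem P hunit).1 h1)
  have hker : RingHom.ker (eval (0 : Fin n → ℂ)) ≤ P := by
    intro f hf
    have hspan : f ∈ Ideal.span (X '' (Set.univ : Set (Fin n))) := by
      rw [mem_ideal_span_X_image]
      intro s hs
      by_contra! hcon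
      have hs0 : s = 0 := by
        ext i
        exact hcon i (Set.mem_univ i)
      subst hs0
      rw [mem_support_iff] at hs
      rw [RingHom.mem_ker, eval_zero] at hf
      exact hs hf
    refine Ideal.span_le.2 ?_ hspan
    rintro _ ⟨i, -, rfl⟩
    exact hX i
  have h1 := (MvPolynomial.le_height_ker_eval_zero ℂ n).trans (Ideal.height_mono hker)
  have h2 := h1.trans (Matrix.height_le_four_of_mem_minimalPrimes_adjugateIdeal M hP)
  have h3 : n ≤ 4 := by exact_mod_cast h2
  omega

/-- A singular matrix with nonzero adjugate is equivalent, by factors of determinant one,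
to the diagonal matrix with a single zero at any prescribed position. -/
theorem Matrix.exists_mul_mul_submatrix_eq_diagonal {ι K : Type*} [Fintype ι] [DecidableEq ι]
    [Field K] (A : Matrix ι ι K) (hdet : A.det = 0) (hadj : A.adjugate ≠ 0) (z : ι) :
    ∃ (L K' : Matrix ι ι K) (σ : Equiv.Perm ι), L.det = 1 ∧ K'.det = 1 ∧
      (L * A * K').submatrix σ σ = diagonal (Function.update 1 z 0) := by
  obtain ⟨T, T', D, hD⟩ := Pivot.exists_list_transvec_mul_mul_list_transvec_eq_diagonal A
  set L := (T.map TransvectionStruct.toMatrix).prod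
  set L' := (T'.map TransvectionStruct.toMatrix).prod
  have hL : L.det = 1 := TransvectionStruct.det_toMatrix_prod T
  have hL' : L'.det = 1 := TransvectionStruct.det_toMatrix_prod T'
  have hDdet : ∏ i, D i = 0 := by
    rw [← det_diagonal, ← hD, det_mul, det_mul, hdet, mul_zero, zero_mul]
  have hDadj : (diagonal D).adjugate ≠ 0 := by
    intro h
    apply hadj
    have h1 : L' * (diagonal D).adjugate * L = A.adjugate := by
      rw [← hD, adjugate_mul_distrib, adjugate_mul_distrib, ← mul_assoc, mul_adjugate, mul_assoc,
        mul_assoc, adjugate_mul, hL, hL']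
      simp
    rw [← h1, h]
    simp
  obtain ⟨i, hi⟩ : ∃ i, ∏ j ∈ Finset.univ.erase i, D j ≠ 0 := by
    by_contra! hcon
    apply hDadj
    rw [adjugate_diagonal]
    ext a b
    simp [diagonal_apply, hcon]
  have hDi : D i = 0 := by
    rw [← Finset.mul_prod_erase _ _ (Finset.mem_univ i)] at hDdet
    exact (mul_eq_zero.1 hDdet).resolve_right hi
  have hDj (j : ι) (hj : j ≠ i) : D j ≠ 0 :=
    Finset.prod_ne_zero_iff.1 hi j (by simp [hj])
  let c : ι → K := Function.update D⁻¹ i (∏ j ∈ Finset.univ.erase i, D j)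
  refine ⟨diagonal c * L, L', Equiv.swap z i, ?_, hL', ?_⟩
  · rw [det_mul, hL, mul_one, det_diagonal, ← Finset.mul_prod_erase _ _ (Finset.mem_univ i)]
    have : ∏ j ∈ Finset.univ.erase i, c j = ∏ j ∈ Finset.univ.erase i, (D j)⁻¹ :=
      Finset.prod_congr rfl fun j hj => by simp [c, Finset.ne_of_mem_erase hj]
    rw [this, Finset.prod_inv_distrib]
    simp [c, hi]
  · rw [mul_assoc, mul_assoc, ← mul_assoc L, hD, diagonal_mul_diagonal,
      submatrix_diagonal_equiv]
    congr 1
    ext j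
    rcases eq_or_ne j z with rfl | hj
    · simp [hDi]
    · have hne : Equiv.swap z i j ≠ i := by
        rw [Ne, Equiv.swap_apply_eq_iff, Equiv.swap_apply_right]
        exact hj
      simp [c, hj, hne, hDj _ hne]

theorem MvPolynomial.totalDegree_map_C_mul_mul_map_C_le {σ ι R : Type*} [CommRing R] [Fintype ι]
    {N : ℕ} (L K : Matrix ι ι R) (M : Matrix ι ι (MvPolynomial σ R))
    (hM : ∀ i j, (M i j).totalDegree ≤ N) (i j : ι) :
    ((L.map (C : R → MvPolynomial σ R) * M * K.map (C : R → MvPolynomial σ R)) i j).totalDegree ≤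
      N := by
  simp only [Matrix.mul_apply, Matrix.map_apply]
  refine totalDegree_finsetSum_le fun k _ => (totalDegree_mul _ _).trans ?_
  rw [totalDegree_C, add_zero]
  refine totalDegree_finsetSum_le fun l _ => (totalDegree_mul _ _).trans ?_
  rw [totalDegree_C, zero_add]
  exact hM l k

/-- Reduction to normal form. If `det M = ∑_{i=1}^n x_i^d` with `d ≥ 2`,
`n ≥ 5`, then there is a matrix `M̃` of polynomials, with the maximum degree of its entries
at most the maximum degree of the entries of `M`, with `det M̃ = ∑_{i=1}^n x_i^d`, whose
constant part `M̃(0)` is diagonal with `(M̃(0))_{1,1} = 0` and `(M̃(0))_{i,i} = 1` for `i ≥ 2`. -/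
theorem normal_form_reduction (n d m : ℕ) (hd : 2 ≤ d) (hn : 5 ≤ n)
    (M : Matrix (Fin m) (Fin m) (MvPolynomial (Fin n) ℂ))
    (hdet : M.det = ∑ i : Fin n, X i ^ d) :
    ∃ Mt : Matrix (Fin m) (Fin m) (MvPolynomial (Fin n) ℂ),
      (∀ i j, (Mt i j).totalDegree ≤
          Finset.univ.sup fun p : Fin m × Fin m => (M p.1 p.2).totalDegree) ∧
      Mt.det = ∑ i : Fin n, X i ^ d ∧
      (∀ i j, i ≠ j → eval (0 : Fin n → ℂ) (Mt i j) = 0) ∧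
      (∀ i : Fin m, i.val = 0 → eval (0 : Fin n → ℂ) (Mt i i) = 0) ∧
      (∀ i : Fin m, i.val ≠ 0 → eval (0 : Fin n → ℂ) (Mt i i) = 1) := by
  rcases m with _ | m
  · exact ⟨M, fun i => i.elim0, hdet, fun i => i.elim0, fun i => i.elim0, fun i => i.elim0⟩
  have hA : (M.map (eval (0 : Fin n → ℂ))).det = 0 := by
    have h := RingHom.map_det (eval (0 : Fin n → ℂ)) M
    rw [RingHom.mapMatrix_apply] at h
    rw [← h, hdet]
    simp [show d ≠ 0 by omega]
  obtain ⟨L, K, σ, hL, hK, hdiag⟩ := Matrix.exists_mul_mul_submatrix_eq_diagonal _ hA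
    (adjugate_map_eval_zero_ne_zero hd hn M hdet) 0
  set Mt := (L.map C * M * K.map C).submatrix σ σ with hMt
  have hmap : Mt.map (eval (0 : Fin n → ℂ)) = Matrix.diagonal (Function.update 1 0 0) := by
    rw [← hdiag, hMt, ← Matrix.submatrix_map, Matrix.map_mul, Matrix.map_mul]
    congr 3 <;> ext <;> simp
  have heval (i j : Fin (m + 1)) : eval (0 : Fin n → ℂ) (Mt i j) =
      (Matrix.diagonal (Function.update 1 0 0) : Matrix (Fin (m + 1)) (Fin (m + 1)) ℂ) i j := by
    rw [← hmap, Matrix.map_apply]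
  refine ⟨Mt, fun i j => ?_, ?_, fun i j hij => ?_, fun i hi => ?_, fun i hi => ?_⟩
  · exact totalDegree_map_C_mul_mul_map_C_le L K M (fun i j => Finset.le_sup
      (f := fun p : Fin (m + 1) × Fin (m + 1) => (M p.1 p.2).totalDegree)
      (Finset.mem_univ (i, j))) _ _
  · have hC (A : Matrix (Fin (m + 1)) (Fin (m + 1)) ℂ) (hA : A.det = 1) :
        (A.map (C : ℂ →+* MvPolynomial (Fin n) ℂ)).det = 1 := by
      rw [← RingHom.mapMatrix_apply, ← RingHom.map_det, hA, map_one]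
    rw [hMt, Matrix.det_submatrix_equiv_self, Matrix.det_mul, Matrix.det_mul, hC L hL, hC K hK,
      one_mul, mul_one, hdet]
  · rw [heval, Matrix.diagonal_apply_ne _ hij]
  · obtain rfl : i = 0 := Fin.ext hi
    rw [heval]
    simp
  · have : i ≠ 0 := fun h => hi (by simp [h])
    rw [heval]
    simp [this]
end

section
/- Let d ≥ 2 and n ≥ 5 be natural numbers, and let M be an m × m matrix of polynomials in ℂ[x_1, ..., x_n] such that det(M) = ∑_{i=1}^n x_i^d as polynomials. Then for every point a ∈ ℂ^n, the scalar matrix M(a) ∈ ℂ^{m×m} obtained by evaluating every entry at a has rank at least m − 1. Equivalently, the image of the polynomial map M : ℂ^n → ℂ^{m×m} is disjoint from the singular locus of the m × m determinant. -/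
open MvPolynomial

namespace Derivation

theorem leibniz_prod {k A ι : Type*} [CommRing k] [CommRing A] [Algebra k A]
    [DecidableEq ι] (D : Derivation k A A) (s : Finset ι) (f : ι → A) :
    D (∏ i ∈ s, f i) = ∑ i ∈ s, (∏ j ∈ s.erase i, f j) * D (f i) := by
  induction s using Finset.induction_on with
  | empty => simp
  | insert a s ha ih =>
    rw [Finset.prod_insert ha, D.leibniz, ih, Finset.sum_insert ha, Finset.erase_insert ha,
      smul_eq_mul, smul_eq_mul, add_comm, Finset.mul_sum]
    congr 1
    refine Finset.sum_congr rfl fun i hi => ?_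
    have hai : a ≠ i := fun h => ha (h ▸ hi)
    rw [Finset.erase_insert_of_ne hai, Finset.prod_insert (by simp [ha]), mul_assoc]

/-- Jacobi's formula for a derivation. -/
theorem map_det {k R n : Type*} [CommRing k] [CommRing R] [Algebra k R] [Fintype n]
    [DecidableEq n] (D : Derivation k R R) (A : Matrix n n R) :
    D A.det = ∑ i, ∑ j, A.adjugate i j * D (A j i) := by
  have h (i : n) : ∑ j, A.adjugate i j * D (A j i) = (A.updateCol i fun j => D (A j i)).det := by
    rw [← Matrix.cramer_apply, Matrix.cramer_eq_adjugate_mulVec]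
    rfl
  simp_rw [h, Matrix.det_apply, map_sum]
  rw [Finset.sum_comm]
  refine Finset.sum_congr rfl fun σ _ => ?_
  rw [Units.smul_def, map_zsmul, D.leibniz_prod, Finset.smul_sum]
  refine Finset.sum_congr rfl fun i _ => ?_
  rw [Units.smul_def, ← Finset.prod_erase_mul _ _ (Finset.mem_univ i), Matrix.updateCol_self]
  congr 2
  refine Finset.prod_congr rfl fun j hj => ?_
  rw [Matrix.updateCol_ne (Finset.ne_of_mem_erase hj)]

end Derivation

namespace Matrix

variable {R : Type*} [CommRing R]

section Adjugate

variable {m n : Type*} [Fintype m] [DecidableEq m] [Fintype n] [DecidableEq n]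

theorem adjugate_fromBlocks_one₂₂ (S : Matrix n n R) :
    (fromBlocks S 0 0 (1 : Matrix PUnit.{1} PUnit.{1} R)).adjugate =
      fromBlocks S.adjugate 0 0 (S.det • 1) := by
  ext (i | i) (j | j)
  · rw [fromBlocks_apply₁₁, adjugate_apply, adjugate_apply]
    have : (fromBlocks S 0 0 (1 : Matrix PUnit.{1} PUnit.{1} R)).updateRow (Sum.inl j)
        (Pi.single (Sum.inl i) 1) = fromBlocks (S.updateRow j (Pi.single i 1)) 0 0 1 := by
      ext (a | a) (b | b) <;> simp [updateRow_apply, Pi.single_apply]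
    rw [this, det_fromBlocks_zero₂₁, det_one, mul_one]
  · rw [fromBlocks_apply₁₂, adjugate_apply]
    refine det_eq_zero_of_column_eq_zero (Sum.inr j) fun k => ?_
    rcases k with k | k <;> simp [updateRow_apply]
  · rw [fromBlocks_apply₂₁, adjugate_apply]
    refine det_zero_of_row_eq (i := Sum.inl j) (j := Sum.inr i) (by simp) ?_
    ext (k | k) <;> simp [updateRow_apply]
  · rw [fromBlocks_apply₂₂, adjugate_apply]
    have : (fromBlocks S 0 0 (1 : Matrix PUnit.{1} PUnit.{1} R)).updateRow (Sum.inr j)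
        (Pi.single (Sum.inr i) 1) = fromBlocks S 0 0 1 := by
      ext (a | a) (b | b) <;> simp [updateRow_apply]
    rw [this, det_fromBlocks_zero₂₁, det_one, mul_one]
    simp

theorem adjugate_fromBlocks_one₂₂_eq_zero_iff [Nonempty n] (S : Matrix n n R) :
    (fromBlocks S 0 0 (1 : Matrix PUnit.{1} PUnit.{1} R)).adjugate = 0 ↔ S.adjugate = 0 := by
  rw [adjugate_fromBlocks_one₂₂, ← fromBlocks_zero, fromBlocks_inj]
  refine ⟨fun h => h.1, fun h => ⟨h, rfl, rfl, ?_⟩⟩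
  obtain ⟨i⟩ := ‹Nonempty n›
  rw [det_eq_sum_mul_adjugate_row S i, h]
  simp

theorem isUnit_adjugate {U : Matrix n n R} (hU : IsUnit U) : IsUnit U.adjugate := by
  rw [isUnit_iff_isUnit_det, det_adjugate]
  exact ((isUnit_iff_isUnit_det U).1 hU).pow _

theorem adjugate_mul_eq_zero_iff_left {A U : Matrix n n R} (hU : IsUnit U) :
    (A * U).adjugate = 0 ↔ A.adjugate = 0 := by
  rw [adjugate_mul_distrib, (isUnit_adjugate hU).mul_right_eq_zero]

theorem adjugate_mul_eq_zero_iff_right {A U : Matrix n n R} (hU : IsUnit U) :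
    (U * A).adjugate = 0 ↔ A.adjugate = 0 := by
  rw [adjugate_mul_distrib, (isUnit_adjugate hU).mul_left_eq_zero]

theorem adjugate_submatrix_equiv_eq_zero_iff (A : Matrix n n R) (e f : m ≃ n) :
    (A.submatrix e f).adjugate = 0 ↔ A.adjugate = 0 := by
  have h : A.submatrix e f =
      (A * (1 : Matrix n n R).submatrix id (e.symm.trans f)).submatrix e e := by
    ext i j
    simp [Matrix.mul_apply, Matrix.one_apply]
  rw [h, adjugate_submatrix_equiv_self]
  have hU : IsUnit ((1 : Matrix n n R).submatrix id (e.symm.trans f)) := by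
    rw [isUnit_iff_isUnit_det, det_permute', det_one, mul_one]
    exact ((Equiv.Perm.sign (e.symm.trans f)).isUnit.map (Int.castRingHom R))
  rw [← adjugate_mul_eq_zero_iff_left (A := A) hU]
  refine ⟨fun h => ?_, fun h => by rw [h]; rfl⟩
  ext i j
  simpa using congr_fun₂ h (e.symm i) (e.symm j)

theorem exists_eq_mul_fromBlocks_one₂₂_mul (A : Matrix (n ⊕ PUnit.{1}) (n ⊕ PUnit.{1}) R)
    (hA : IsUnit (A (Sum.inr PUnit.unit) (Sum.inr PUnit.unit))) :
    ∃ (U V : Matrix (n ⊕ PUnit.{1}) (n ⊕ PUnit.{1}) R) (S : Matrix n n R),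
      IsUnit U ∧ IsUnit V ∧ A = U * fromBlocks S 0 0 1 * V := by
  have hD : IsUnit A.toBlocks₂₂.det := by rwa [det_unique]
  let := ((isUnit_iff_isUnit_det _).2 hD).invertible
  refine ⟨fromBlocks 1 (A.toBlocks₁₂ * ⅟A.toBlocks₂₂) 0 1,
    fromBlocks 1 0 0 A.toBlocks₂₂ * fromBlocks 1 0 (⅟A.toBlocks₂₂ * A.toBlocks₂₁) 1,
    A.toBlocks₁₁ - A.toBlocks₁₂ * ⅟A.toBlocks₂₂ * A.toBlocks₂₁, ?_, ?_, ?_⟩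
  · rw [isUnit_iff_isUnit_det, det_fromBlocks_zero₂₁]
    simp
  · rw [isUnit_iff_isUnit_det, det_mul, det_fromBlocks_zero₂₁, det_fromBlocks_zero₁₂]
    simpa only [det_one, one_mul, mul_one] using hD
  · conv_lhs => rw [← fromBlocks_toBlocks A, fromBlocks_eq_of_invertible₂₂]
    rw [← mul_assoc]
    congr 1
    rw [mul_assoc]
    congr 1
    simp [fromBlocks_multiply]

theorem adjugate_map {S : Type*} [CommRing S] (f : R →+* S) (A : Matrix n n R) :
    (A.map f).adjugate = A.adjugate.map f :=
  (f.map_adjugate A).symm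

theorem adjugate_mem_iff (A : Matrix n n R) (q : Ideal R) :
    (∀ i j, A.adjugate i j ∈ q) ↔ (A.map (Ideal.Quotient.mk q)).adjugate = 0 := by
  rw [adjugate_map, ← Matrix.ext_iff]
  simp [Ideal.Quotient.eq_zero_iff_mem]

/-- Pivoting at a unit entry of a square matrix does not change the vanishing locus of its
adjugate. -/
theorem exists_adjugate_mem_iff {k : ℕ} [NeZero k] (A : Matrix (Fin (k + 1)) (Fin (k + 1)) R)
    {i j : Fin (k + 1)} (hA : IsUnit (A i j)) :
    ∃ B : Matrix (Fin k) (Fin k) R, ∀ q : Ideal R,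
      (∀ a b, A.adjugate a b ∈ q) ↔ ∀ a b, B.adjugate a b ∈ q := by
  let e (i : Fin (k + 1)) : Fin k ⊕ PUnit.{1} ≃ Fin (k + 1) :=
    ((finSuccEquiv' i).trans (Equiv.optionEquivSumPUnit _)).symm
  obtain ⟨U, V, S, hU, hV, h⟩ :=
    exists_eq_mul_fromBlocks_one₂₂_mul (A.submatrix (e i) (e j)) (by simpa [e] using hA)
  refine ⟨S, fun q => ?_⟩
  have hmap : ∀ {W : Matrix (Fin k ⊕ PUnit.{1}) (Fin k ⊕ PUnit.{1}) R}, IsUnit W →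
      IsUnit (W.map (Ideal.Quotient.mk q)) := fun h => h.map (Ideal.Quotient.mk q).mapMatrix
  rw [adjugate_mem_iff, adjugate_mem_iff, ← adjugate_submatrix_equiv_eq_zero_iff _ (e i) (e j),
    submatrix_map, h, Matrix.map_mul, Matrix.map_mul, adjugate_mul_eq_zero_iff_left (hmap hV),
    adjugate_mul_eq_zero_iff_right (hmap hU), fromBlocks_map,
    ← adjugate_fromBlocks_one₂₂_eq_zero_iff (S.map _)]
  simp

end Adjugate

theorem adjugate_single_apply_eq_zero {k : ℕ} (hk : 2 ≤ k) (c : R) (i j a b : Fin (k + 1)) :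
    (Matrix.single i j c).adjugate a b = 0 := by
  obtain ⟨r, hr⟩ := Finset.exists_mem_notMem_of_card_lt_card (s := {i, b})
    (t := (Finset.univ : Finset (Fin (k + 1))))
    (lt_of_le_of_lt Finset.card_le_two (by simpa using hk))
  simp only [Finset.mem_univ, Finset.mem_insert, Finset.mem_singleton, not_or, true_and] at hr
  rw [adjugate_apply]
  refine det_eq_zero_of_row_eq_zero r fun l => ?_
  rw [updateRow_ne hr.2, Matrix.single_apply_of_row_ne (Ne.symm hr.1)]

theorem pred_le_rank_of_adjugate_ne_zero {K : Type*} [Field K] {m : ℕ}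
    (A : Matrix (Fin m) (Fin m) K) (hA : A.adjugate ≠ 0) : m - 1 ≤ A.rank := by
  obtain _ | m := m
  · simp
  by_contra! h
  refine hA (Matrix.ext fun i j => ?_)
  rw [adjugate_fin_succ_eq_det_submatrix, zero_apply]
  have : (A.submatrix j.succAbove i.succAbove).det = 0 := by
    by_contra hdet
    have h1 := rank_of_det_ne_zero hdet
    have h2 := rank_submatrix_le A j.succAbove i.succAbove
    rw [Fintype.card_fin] at h1
    omega
  rw [this, mul_zero]

section Height

open IsLocalRing

universe u

theorem adjugate_map_localization_mem_iff {R : Type u} [CommRing R] (P : Ideal R) [P.IsPrime]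
    {k : ℕ} (A : Matrix (Fin k) (Fin k) R)
    (hA : ∀ q : Ideal R, q.IsPrime → q ≤ P → ((∀ i j, A.adjugate i j ∈ q) ↔ q = P))
    (q : Ideal (Localization.AtPrime P)) (hq : q.IsPrime) :
    (∀ i j, (A.map (algebraMap R (Localization.AtPrime P))).adjugate i j ∈ q) ↔
      q = maximalIdeal (Localization.AtPrime P) := by
  have hmax : (maximalIdeal (Localization.AtPrime P)).comap (algebraMap R _) = P :=
    IsLocalization.AtPrime.under_maximalIdeal _ P
  have h := hA (q.comap (algebraMap R _)) (hq.comap _)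
    ((Ideal.comap_mono (le_maximalIdeal hq.ne_top)).trans hmax.le)
  simp only [adjugate_map, map_apply, ← Ideal.mem_comap, h]
  refine ⟨fun h => ?_, fun h => by rw [h, hmax]⟩
  rw [← IsLocalization.map_under P.primeCompl (Localization.AtPrime P) q,
    ← IsLocalization.map_under P.primeCompl (Localization.AtPrime P) (maximalIdeal _)]
  exact congrArg _ (h.trans hmax.symm)

theorem height_maximalIdeal_localization {R : Type u} [CommRing R] (P : Ideal R) [P.IsPrime] :
    (maximalIdeal (Localization.AtPrime P)).height = P.height := by
  rw [← IsLocalization.height_under P.primeCompl, IsLocalization.AtPrime.under_maximalIdeal _ P]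

theorem height_maximalIdeal_le_four_of_le_two {R : Type u} [CommRing R] [IsLocalRing R]
    [IsNoetherianRing R] {k : ℕ} (hk : k ≤ 2) (A : Matrix (Fin k) (Fin k) R)
    (hA : ∀ q : Ideal R, q.IsPrime → ((∀ i j, A.adjugate i j ∈ q) ↔ q = maximalIdeal R)) :
    (maximalIdeal R).height ≤ 4 := by
  let f : Fin k × Fin k → R := fun p => A.adjugate p.1 p.2
  have hspan (q : Ideal R) : Ideal.span (Set.range f) ≤ q ↔ ∀ i j, A.adjugate i j ∈ q := by
    simp [Ideal.span_le, Set.range_subset_iff, f]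
  have hmin : maximalIdeal R ∈ (Ideal.span (Set.range f)).minimalPrimes := by
    refine ⟨⟨inferInstance, (hspan _).2 ((hA _ inferInstance).2 rfl)⟩, fun q hq _ => ?_⟩
    exact ((hA q hq.1).1 ((hspan q).1 hq.2)).ge
  refine (Ideal.height_le_card_of_mem_minimalPrimes_span (Set.finite_range f) hmin).trans ?_
  have h1 : (Set.range f).ncard ≤ k * k := by
    rw [← Set.image_univ]
    refine (Set.ncard_image_le Set.finite_univ).trans ?_
    simp [Set.ncard_univ]
  have h2 : k * k ≤ 2 * 2 := Nat.mul_le_mul hk hk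
  exact_mod_cast h1.trans h2

theorem height_maximalIdeal_le_of_isUnit_apply {R : Type u} [CommRing R] [IsLocalRing R]
    {k : ℕ} [NeZero k]
    (ih : ∀ A : Matrix (Fin k) (Fin k) R,
      (∀ q : Ideal R, q.IsPrime → ((∀ i j, A.adjugate i j ∈ q) ↔ q = maximalIdeal R)) →
        (maximalIdeal R).height ≤ 4)
    (A : Matrix (Fin (k + 1)) (Fin (k + 1)) R) {i j : Fin (k + 1)} (hij : IsUnit (A i j))
    (hA : ∀ q : Ideal R, q.IsPrime → ((∀ i j, A.adjugate i j ∈ q) ↔ q = maximalIdeal R)) :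
    (maximalIdeal R).height ≤ 4 := by
  obtain ⟨B, hB⟩ := A.exists_adjugate_mem_iff hij
  exact ih B fun q hq => (hB q).symm.trans (hA q hq)

/-- If the entries of `A` lie in the maximal ideal, then adding an indeterminate to the first entry
gives a matrix whose adjugate vanishes at `(maximalIdeal R)[X]`, and at no smaller prime. -/
theorem adjugate_add_single_X_mem_iff {R : Type u} [CommRing R] [IsLocalRing R]
    [IsNoetherianRing R] {k : ℕ} (hk : 2 ≤ k) (A : Matrix (Fin (k + 1)) (Fin (k + 1)) R)
    (hmem : ∀ i j, A i j ∈ maximalIdeal R)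
    (hA : ∀ q : Ideal R, q.IsPrime → ((∀ i j, A.adjugate i j ∈ q) ↔ q = maximalIdeal R))
    (q : Ideal (Polynomial R)) (hq : q.IsPrime)
    (hle : q ≤ (maximalIdeal R).map Polynomial.C) :
    (∀ i j, (A.map Polynomial.C + Matrix.single 0 0 Polynomial.X).adjugate i j ∈ q) ↔
      q = (maximalIdeal R).map Polynomial.C := by
  set P : Ideal (Polynomial R) := (maximalIdeal R).map Polynomial.C
  have hPprime : P.IsPrime := Ideal.isPrime_map_C_of_isPrime
  constructor
  · intro hadj
    by_contra hne
    have hlt : q < P := lt_of_le_of_ne hle hne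
    let Q : Ideal (Polynomial R) := (maximalIdeal R).comap Polynomial.constantCoeff
    have hQ : Q.IsPrime := Ideal.IsPrime.comap _
    have hPQ : P < Q := by
      refine lt_of_le_of_ne ?_ ?_
      · refine Ideal.map_le_iff_le_comap.2 fun x hx => ?_
        simpa [Q] using hx
      · intro h
        have hX : (Polynomial.X : Polynomial R) ∈ P := by rw [h]; simp [Q]
        have := Ideal.mem_map_C_iff.1 hX 1
        simp at this
    have hqQ : q ≤ Q := hle.trans hPQ.le
    have hmin : Q ∈ (q ⊔ Ideal.span {Polynomial.X}).minimalPrimes := by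
      refine ⟨⟨hQ, sup_le hqQ ?_⟩, fun p hp _ => ?_⟩
      · simp [Ideal.span_le, Q]
      · have hpX : (Polynomial.X : Polynomial R) ∈ p :=
          hp.2 (Ideal.mem_sup_right (Ideal.mem_span_singleton_self _))
        have hpA : ∀ i j, A.adjugate i j ∈ p.comap Polynomial.C := by
          rw [adjugate_mem_iff]
          have h1 : ∀ i j, (A.map Polynomial.C + Matrix.single 0 0 Polynomial.X).adjugate i j ∈ p :=
            fun i j => hp.2 (Ideal.mem_sup_left (hadj i j))
          rw [adjugate_mem_iff, Matrix.map_add _ (map_add _), Matrix.map_single,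
            Ideal.Quotient.eq_zero_iff_mem.2 hpX, Matrix.single_zero, add_zero,
            ← adjugate_mem_iff] at h1
          rw [← adjugate_mem_iff]
          intro i j
          simpa [adjugate_map] using h1 i j
        have hpm := (hA _ (hp.1.comap _)).1 hpA
        intro f hf
        have hf0 : Polynomial.C (f.coeff 0) ∈ p := by
          rw [← Ideal.mem_comap, hpm]
          simpa [Q] using hf
        rw [← Polynomial.divX_mul_X_add f]
        exact p.add_mem (p.mul_mem_left _ hpX) hf0
    have h1 := Ideal.map_height_le_one_of_mem_minimalPrimes hmin
    have hker : RingHom.ker (Ideal.Quotient.mk q) = q := Ideal.mk_ker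
    have hP' := Ideal.map_isPrime_of_surjective (Ideal.Quotient.mk_surjective (I := q))
      (hker.trans_le hle)
    have hQ' := Ideal.map_isPrime_of_surjective (Ideal.Quotient.mk_surjective (I := q))
      (hker.trans_le hqQ)
    have hlt' : P.map (Ideal.Quotient.mk q) < Q.map (Ideal.Quotient.mk q) := by
      refine lt_of_le_of_ne (Ideal.map_mono hPQ.le) fun h => hPQ.ne ?_
      have h2 := congrArg (Ideal.comap (Ideal.Quotient.mk q)) h
      rwa [Ideal.comap_map_mk hle, Ideal.comap_map_mk hqQ] at h2
    have h2 := (Ideal.height_add_one_le_of_lt_of_isPrime hlt').trans h1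
    have h3 : (P.map (Ideal.Quotient.mk q)).height = 0 := by
      rw [← nonpos_iff_eq_zero]
      exact (ENat.add_le_add_iff_right ENat.one_ne_top).1 (h2.trans (zero_add 1).ge)
    rw [Ideal.height_eq_zero_iff_eq_bot, Ideal.map_eq_bot_iff_le_ker, hker] at h3
    exact hlt.not_ge h3
  · rintro rfl
    rw [adjugate_mem_iff]
    have : (A.map Polynomial.C + Matrix.single 0 0 Polynomial.X).map (Ideal.Quotient.mk P) =
        Matrix.single 0 0 (Ideal.Quotient.mk P Polynomial.X) := by
      rw [Matrix.map_add _ (map_add _), Matrix.map_single]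
      convert zero_add _
      ext i j
      simpa [Ideal.Quotient.eq_zero_iff_mem] using Ideal.mem_map_of_mem _ (hmem i j)
    rw [this]
    ext i j
    exact adjugate_single_apply_eq_zero hk _ _ _ _ _

/-- If the maximal ideal of a Noetherian local ring is the only prime containing the submaximal
minors of a square matrix, then it has height at most four. -/
theorem height_maximalIdeal_le_four {k : ℕ} {R : Type u} [CommRing R] [IsLocalRing R]
    [IsNoetherianRing R] (A : Matrix (Fin k) (Fin k) R)
    (hA : ∀ q : Ideal R, q.IsPrime → ((∀ i j, A.adjugate i j ∈ q) ↔ q = maximalIdeal R)) :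
    (maximalIdeal R).height ≤ 4 := by
  induction k generalizing R with
  | zero => exact height_maximalIdeal_le_four_of_le_two (by simp) A hA
  | succ k ih =>
    obtain hk | hk := Nat.lt_or_ge k 2
    · exact height_maximalIdeal_le_four_of_le_two hk A hA
    have : NeZero k := ⟨by omega⟩
    by_cases hunit : ∃ i j, IsUnit (A i j)
    · obtain ⟨i, j, hij⟩ := hunit
      exact height_maximalIdeal_le_of_isUnit_apply ih A hij hA
    have hmem : ∀ i j, A i j ∈ maximalIdeal R := fun i j =>
      (mem_maximalIdeal _).2 fun h => hunit ⟨i, j, h⟩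
    let P : Ideal (Polynomial R) := (maximalIdeal R).map Polynomial.C
    have hP : P.IsPrime := Ideal.isPrime_map_C_of_isPrime
    rw [← Polynomial.height_map_C, ← height_maximalIdeal_localization P]
    refine height_maximalIdeal_le_of_isUnit_apply (i := 0) (j := 0) ih _ ?_
      (adjugate_map_localization_mem_iff P _ (adjugate_add_single_X_mem_iff hk A hmem hA))
    rw [map_apply, IsLocalization.AtPrime.isUnit_to_map_iff _ P]
    intro h
    have := Ideal.mem_map_C_iff.1 h 1
    simp at this

end Height

end Matrix

namespace MvPolynomial

theorem le_height_ker_eval (K : Type*) [Field K] (n : ℕ) :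
    (n : ℕ∞) ≤ (RingHom.ker (eval (0 : Fin n → K))).height := by
  let φ (i : ℕ) : MvPolynomial (Fin n) K →ₐ[K] MvPolynomial (Fin n) K :=
    aeval fun j => if (j : ℕ) < i then 0 else X j
  have hprime (i : ℕ) : (RingHom.ker (φ i)).IsPrime := RingHom.ker_isPrime _
  have hle (i : ℕ) (hi : i ≤ n) : (i : ℕ∞) ≤ (RingHom.ker (φ i)).height := by
    induction i with
    | zero => simp
    | succ i ih =>
      have hlt : RingHom.ker (φ i) < RingHom.ker (φ (i + 1)) := by
        refine lt_of_le_of_ne (fun p hp => ?_) fun h => ?_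
        · have hcomp : (φ (i + 1)).comp (φ i) = φ (i + 1) := by
            ext1 j
            simp only [φ, AlgHom.comp_apply, aeval_X]
            split_ifs <;> simp <;> omega
          rw [RingHom.mem_ker] at hp ⊢
          rw [← hcomp, AlgHom.comp_apply, hp, map_zero]
        · have hX : X ⟨i, hi⟩ ∈ RingHom.ker (φ (i + 1)) := by simp [φ, RingHom.mem_ker]
          rw [← h] at hX
          simp [φ, RingHom.mem_ker] at hX
      push_cast
      exact (add_le_add_left (ih (by omega)) 1).trans
        (Ideal.height_add_one_le_of_lt_of_isPrime hlt)
  refine (hle n le_rfl).trans (Ideal.height_mono fun p hp => ?_)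
  have hcomp : ((aeval (0 : Fin n → K)).comp (φ n)) = aeval (0 : Fin n → K) := by
    ext j
    simp [φ]
  rw [RingHom.mem_ker] at hp ⊢
  rw [← coe_aeval_eq_eval, RingHom.coe_coe, ← hcomp, AlgHom.comp_apply, hp, map_zero]

end MvPolynomial

/-- If `det M = ∑_{i=1}^n x_i^d` with `d ≥ 2` and `n ≥ 5`, then for every
point `a ∈ ℂ^n`, the evaluated matrix `M(a) ∈ ℂ^{m×m}` has rank at least `m - 1`;
equivalently, the image of the polynomial map `M` misses the singular locus of `Det_m`. -/
theorem image_misses_singular_locus (n d m : ℕ) (hd : 2 ≤ d) (hn : 5 ≤ n)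
    (M : Matrix (Fin m) (Fin m) (MvPolynomial (Fin n) ℂ))
    (hdet : M.det = ∑ i : Fin n, X i ^ d) :
    ∀ a : Fin n → ℂ, m - 1 ≤ (M.map (eval a)).rank := by
  intro a
  refine Matrix.pred_le_rank_of_adjugate_ne_zero _ fun hadj => ?_
  have hX {q : Ideal (MvPolynomial (Fin n) ℂ)} (hq : q.IsPrime)
      (hadj : ∀ i j, M.adjugate i j ∈ q) (i : Fin n) : X i ∈ q := by
    have h1 : pderiv i M.det ∈ q := by
      rw [Derivation.map_det]
      exact q.sum_mem fun _ _ => q.sum_mem fun _ _ => q.mul_mem_right _ (hadj _ _)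
    have h2 : pderiv i M.det = C (d : ℂ) * X i ^ (d - 1) := by
      rw [hdet, map_sum, Finset.sum_eq_single i]
      · simp [Derivation.leibniz_pow]
      · intro j _ hj
        simp [Derivation.leibniz_pow, pderiv_X_of_ne hj]
      · simp
    rw [h2] at h1
    refine hq.mem_of_pow_mem _ ((hq.mem_or_mem h1).resolve_left fun h => hq.ne_top ?_)
    refine q.eq_top_of_isUnit_mem h (IsUnit.map C ?_)
    exact isUnit_iff_ne_zero.2 (Nat.cast_ne_zero.2 (by omega))
  let P : Ideal (MvPolynomial (Fin n) ℂ) := RingHom.ker (eval a)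
  have hP : P.IsPrime := RingHom.ker_isPrime _
  have hMP (i j) : M.adjugate i j ∈ P := by
    rw [Matrix.adjugate_map] at hadj
    exact congr_fun₂ hadj i j
  have ha : a = 0 := funext fun i => by simpa [P, RingHom.mem_ker] using hX hP hMP i
  have hmin (q : Ideal (MvPolynomial (Fin n) ℂ)) (hq : q.IsPrime) (hqP : q ≤ P) :
      (∀ i j, M.adjugate i j ∈ q) ↔ q = P := by
    refine ⟨fun h => le_antisymm hqP fun p hp => ?_, fun h => h ▸ hMP⟩
    have hp0 : constantCoeff p = 0 := by
      rw [← eval_zero]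
      simpa [P, ha, RingHom.mem_ker] using hp
    have : p ∈ idealOfVars (Fin n) ℂ := by
      rw [← pow_one (idealOfVars (Fin n) ℂ), mem_pow_idealOfVars_iff']
      intro x hx
      rw [Nat.lt_one_iff, Finsupp.degree_eq_zero_iff] at hx
      rw [hx]
      exact hp0
    exact Ideal.span_le.2 (Set.range_subset_iff.2 (hX hq h)) this
  have h4 := Matrix.height_maximalIdeal_le_four _
    (Matrix.adjugate_map_localization_mem_iff P M hmin)
  rw [Matrix.height_maximalIdeal_localization] at h4
  have hn' := (le_height_ker_eval ℂ n).trans (by simpa [P, ha] using h4)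
  have : n ≤ 4 := by exact_mod_cast hn'
  omega
end

section
/- Let d ≥ 2 and n ≥ 5 be natural numbers, and let M be an m × m matrix of polynomials in ℂ[x_1, ..., x_n] such that det(M) = ∑_{i=1}^n x_i^d as polynomials. Then the constant part M(0) ∈ ℂ^{m×m} has rank exactly m − 1. -/
open MvPolynomial

universe u

/-- The derivative of a determinant, expressed through the adjugate. -/
theorem Derivation.map_matrix_det {R A κ : Type*} [CommRing R] [CommRing A] [Algebra R A]
    [Fintype κ] [DecidableEq κ] (D : Derivation R A A) (M : Matrix κ κ A) :
    D M.det = ∑ i, (M.adjugate.mulVec fun j => D (M j i)) i := by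
  have hprod : ∀ (s : Finset κ) (f : κ → A),
      D (∏ i ∈ s, f i) = ∑ i ∈ s, ∏ j ∈ s, Function.update f i (D (f i)) j := by
    intro s f
    induction s using Finset.induction_on with
    | empty => simp
    | insert a s ha ih =>
      rw [Finset.prod_insert ha, D.leibniz, ih, Finset.sum_insert ha, Finset.prod_insert ha,
        smul_eq_mul, smul_eq_mul, Finset.mul_sum, Function.update_self,
        Finset.prod_update_of_notMem ha, add_comm, mul_comm]
      congr 1
      refine Finset.sum_congr rfl fun i hi => ?_
      rw [Finset.prod_insert ha, Function.update_of_ne (by rintro rfl; exact ha hi)]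
  simp_rw [← Matrix.cramer_eq_adjugate_mulVec, Matrix.cramer_apply, Matrix.det_apply, map_sum]
  rw [Finset.sum_comm]
  refine Finset.sum_congr rfl fun σ _ => ?_
  rw [Units.smul_def, map_zsmul, hprod, Finset.smul_sum]
  refine Finset.sum_congr rfl fun i _ => ?_
  rw [Units.smul_def]
  congr 1
  refine Finset.prod_congr rfl fun j _ => ?_
  by_cases h : j = i
  · subst h; simp
  · simp [h]

/-- A square matrix whose last two columns are combinations of the others has zero adjugate. -/
theorem Matrix.adjugate_fromCols_mul_eq_zero {R ρ : Type*} [CommRing R] [Fintype ρ] [DecidableEq ρ]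
    (P : Matrix (ρ ⊕ Fin 2) ρ R) (W : Matrix ρ (Fin 2) R) :
    (Matrix.fromCols P (P * W)).adjugate = 0 := by
  have hfac : Matrix.fromCols P (P * W) =
      Matrix.fromCols P (0 : Matrix (ρ ⊕ Fin 2) (Fin 2) R) * Matrix.fromBlocks 1 W 0 0 := by
    rw [← Matrix.fromRows_fromCols_eq_fromBlocks, Matrix.fromCols_mul_fromRows]
    simp [Matrix.mul_fromCols]
  have hzero : (Matrix.fromCols P (0 : Matrix (ρ ⊕ Fin 2) (Fin 2) R)).adjugate = 0 := by
    ext i j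
    rw [Matrix.adjugate_def, Matrix.of_apply, Matrix.cramer_transpose_apply]
    have key : ∀ k : Fin 2, (Matrix.fromCols P (0 : Matrix (ρ ⊕ Fin 2) (Fin 2) R)).col
        (Sum.inr k) = 0 := by
      intro k; ext a; simp
    obtain ⟨k, hk⟩ : ∃ k : Fin 2, Sum.inr k ≠ i := by
      rcases i with i | i
      · exact ⟨0, by simp⟩
      · exact ⟨i + 1, by fin_cases i <;> simp⟩
    refine Matrix.det_eq_zero_of_column_eq_zero (Sum.inr k) fun a => ?_
    rw [Matrix.updateRow_apply]
    split_ifs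
    · simp [hk]
    · simp
  rw [hfac, Matrix.adjugate_mul_distrib, hzero, mul_zero]

namespace MvPolynomial

section KillVars

variable {σ K : Type*} [DecidableEq σ] [Field K]

/-- The substitution sending the variables in `s` to zero. -/
noncomputable def killVars (s : Finset σ) : MvPolynomial σ K →ₐ[K] MvPolynomial σ K :=
  aeval fun i => if i ∈ s then 0 else X i

theorem killVars_X (s : Finset σ) (i : σ) :
    killVars s (X i : MvPolynomial σ K) = if i ∈ s then 0 else X i := by
  simp [killVars]

theorem killVars_killVars {s t : Finset σ} (h : s ⊆ t) (p : MvPolynomial σ K) :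
    killVars t (killVars s p) = killVars t p := by
  have : (killVars t).comp (killVars s) = (killVars t : MvPolynomial σ K →ₐ[K] _) := by
    ext1 i
    by_cases hi : i ∈ s
    · simp [killVars_X, hi, h hi]
    · simp [killVars_X, hi]
  exact DFunLike.congr_fun this p

theorem killVars_univ [Fintype σ] (p : MvPolynomial σ K) :
    killVars Finset.univ p = C (constantCoeff p) := by
  have : (killVars Finset.univ : MvPolynomial σ K →ₐ[K] _) =
      (Algebra.ofId K _).comp (aeval fun _ => 0) := by
    ext1 i
    simp [killVars_X]
  rw [this]
  simp [Algebra.ofId_apply, constantCoeff_eq, algebraMap_eq]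

theorem height_ker_killVars_insert {T : Type*} [CommRing T] (φ : T →+* MvPolynomial σ K)
    {s : Finset σ} {a : σ} (ha : a ∉ s) {δ : MvPolynomial σ K} (hδ : killVars s δ ≠ 0)
    (hr : δ * X a ∈ φ.range) :
    (RingHom.ker ((killVars s : MvPolynomial σ K →ₐ[K] _).toRingHom.comp φ)).height + 1 ≤
      (RingHom.ker ((killVars (insert a s) : MvPolynomial σ K →ₐ[K] _).toRingHom.comp φ)).height := by
  have := RingHom.ker_isPrime ((killVars s : MvPolynomial σ K →ₐ[K] _).toRingHom.comp φ)
  have := RingHom.ker_isPrime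
    ((killVars (insert a s) : MvPolynomial σ K →ₐ[K] _).toRingHom.comp φ)
  refine Ideal.height_add_one_le_of_lt_of_isPrime (SetLike.lt_iff_le_and_exists.2 ⟨?_, ?_⟩)
  · intro t ht
    have ht' : killVars s (φ t) = 0 := ht
    have : killVars (insert a s) (φ t) = 0 := by
      rw [← killVars_killVars (Finset.subset_insert a s), ht', map_zero]
    exact this
  · obtain ⟨t, ht⟩ := hr
    refine ⟨t, ?_, fun h => ?_⟩
    · have : killVars (insert a s) (φ t) = 0 := by simp [ht, killVars_X]
      exact this
    · have : killVars s (φ t) = 0 := h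
      rw [ht, map_mul, killVars_X, if_neg ha] at this
      exact mul_ne_zero hδ (X_ne_zero a) this

/-- If a subring of a polynomial ring contains all variables outside `ω`, and for each variable in
`ω` a multiple of it by a polynomial that does not vanish when `ω` is killed, then the contraction
of the ideal of the origin has height at least the number of variables. -/
theorem card_le_height_ker_constantCoeff [Fintype σ] {T : Type*} [CommRing T]
    (φ : T →+* MvPolynomial σ K) (ω : Finset σ)
    (hω : ∀ a ∈ ω, ∃ δ : MvPolynomial σ K, killVars ω δ ≠ 0 ∧ δ * X a ∈ φ.range)
    (hτ : ∀ a ∉ ω, X a ∈ φ.range) :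
    (Fintype.card σ : ℕ∞) ≤ (RingHom.ker (constantCoeff.comp φ)).height := by
  have h1 : ∀ s : Finset σ, s ⊆ ω → (s.card : ℕ∞) ≤
      (RingHom.ker ((killVars s : MvPolynomial σ K →ₐ[K] _).toRingHom.comp φ)).height := by
    intro s
    induction s using Finset.induction_on with
    | empty => simp
    | insert a s ha ih =>
      intro hs
      rw [Finset.insert_subset_iff] at hs
      obtain ⟨δ, hδ, hr⟩ := hω a hs.1
      rw [Finset.card_insert_of_notMem ha, Nat.cast_add, Nat.cast_one]
      refine le_trans (by gcongr; exact ih hs.2) (height_ker_killVars_insert φ ha (δ := δ) ?_ hr)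
      intro h
      apply hδ
      rw [← killVars_killVars hs.2, h, map_zero]
  have h2 : ∀ t : Finset σ, ω.card + (t \ ω).card ≤
      (RingHom.ker ((killVars (ω ∪ t) : MvPolynomial σ K →ₐ[K] _).toRingHom.comp φ)).height := by
    intro t
    induction t using Finset.induction_on with
    | empty => simpa using h1 ω subset_rfl
    | insert a t ha ih =>
      by_cases haω : a ∈ ω
      · rwa [Finset.insert_sdiff_of_mem _ haω, Finset.union_insert,
          Finset.insert_eq_of_mem (Finset.mem_union_left _ haω)]
      · rw [Finset.insert_sdiff_of_notMem _ haω, Finset.union_insert,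
          Finset.card_insert_of_notMem (by simp [ha]), Nat.cast_add, Nat.cast_one, ← add_assoc]
        refine le_trans (by gcongr) (height_ker_killVars_insert φ (δ := 1) ?_ ?_ ?_)
        · simp [ha, haω]
        · simp
        · simpa using hτ a haω
  have h3 := h2 Finset.univ
  rw [← Nat.cast_add, add_comm, Finset.card_sdiff_add_card_eq_card (Finset.subset_univ _),
    Finset.card_univ, Finset.union_eq_right.2 (Finset.subset_univ ω)] at h3
  refine h3.trans (Ideal.height_mono fun t ht => ?_)
  have ht' : killVars Finset.univ (φ t) = 0 := ht
  rw [killVars_univ, C_eq_zero] at ht'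
  exact ht'

end KillVars

end MvPolynomial

/-- If the constant part of a square matrix `N` of polynomials in at least five variables has two
zero columns, then there is a nonzero point over some domain at which the corank of `N` is at least
two. -/
theorem MvPolynomial.exists_ne_zero_adjugate_eq_zero {K ι ρ : Type u} [Field K]
    [Fintype ι] [Fintype ρ] [DecidableEq ρ] (hι : 5 ≤ Fintype.card ι)
    (N : Matrix (ρ ⊕ Fin 2) (ρ ⊕ Fin 2) (MvPolynomial ι K))
    (hN : ∀ i j, constantCoeff (N i (Sum.inr j)) = 0) :
    ∃ (B : Type u) (_ : CommRing B) (_ : IsDomain B) (_ : Algebra K B) (x : ι → B),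
      x ≠ 0 ∧ (N.map (aeval x)).adjugate = 0 := by
  classical
  let κ := ρ ⊕ Fin 2
  let σ := (ι ⊕ κ × ρ) ⊕ (ρ × Fin 2)
  let P : Matrix κ ρ (MvPolynomial σ K) := fun i k =>
    C (constantCoeff (N i (Sum.inl k))) + X (Sum.inl (Sum.inr (i, k)))
  let W : Matrix ρ (Fin 2) (MvPolynomial σ K) := fun k j => X (Sum.inr (k, j))
  let Y : Matrix κ κ (MvPolynomial σ K) := Matrix.fromCols P (P * W)
  have hYadj : Y.adjugate = 0 := Matrix.adjugate_fromCols_mul_eq_zero P W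
  have hP : ∀ i k, P i k = C (constantCoeff (N i (Sum.inl k))) + X (Sum.inl (Sum.inr (i, k))) :=
    fun _ _ => rfl
  have hYinl : ∀ i k, Y i (Sum.inl k) = P i k := fun _ _ => rfl
  have hYinr : ∀ i j, Y i (Sum.inr j) = ∑ l, P i l * X (Sum.inr (l, j)) := fun _ _ => rfl
  have hYc : ∀ i j, constantCoeff (Y i j) = constantCoeff (N i j) := by
    rintro i (k | j)
    · simp [hYinl, hP]
    · simp [hYinr, hN]
  let gen : ι ⊕ κ × κ → MvPolynomial σ K :=
    Sum.elim (fun i => X (Sum.inl (Sum.inl i))) fun p => Y p.1 p.2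
  let T := (aeval gen : MvPolynomial (ι ⊕ κ × κ) K →ₐ[K] MvPolynomial σ K).range
  let ψ : MvPolynomial (ι ⊕ κ × κ) K →ₐ[K] T := (aeval gen).rangeRestrict
  have hψ : Function.Surjective ψ := (aeval gen).rangeRestrict_surjective
  have hψv : ∀ p, (ψ p : MvPolynomial σ K) = aeval gen p := fun p => rfl
  have hTr : ∀ p, aeval gen p ∈ T.val.toRingHom.range := fun p => ⟨ψ p, rfl⟩
  have hYr : ∀ i j, Y i j ∈ T.val.toRingHom.range := fun i j => by
    simpa [gen] using hTr (X (Sum.inr (i, j)))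
  -- the ideal of the origin in `T`
  let 𝔪 : Ideal T := RingHom.ker ((constantCoeff : MvPolynomial σ K →+* K).comp T.val.toRingHom)
  have h𝔪 : 𝔪.IsPrime := RingHom.ker_isPrime _
  have hheight : (Fintype.card σ : ℕ∞) ≤ 𝔪.height := by
    let A : Matrix ρ ρ (MvPolynomial σ K) := fun i k => P (Sum.inl i) k
    refine card_le_height_ker_constantCoeff T.val.toRingHom
      (Finset.univ.map Function.Embedding.inr) ?_ ?_
    · rintro a ha
      obtain ⟨⟨k, j⟩, -, rfl⟩ := Finset.mem_map.1 ha
      refine ⟨A.det, ?_, ?_⟩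
      · intro h0
        let v : σ → K := Sum.elim (Sum.elim 0 fun p =>
          (if p.1 = Sum.inl p.2 then 1 else 0) - constantCoeff (N p.1 (Sum.inl p.2))) 0
        let e : MvPolynomial σ K →ₐ[K] K :=
          (aeval v).comp (killVars (Finset.univ.map Function.Embedding.inr))
        have h1 : e A.det = 1 := by
          rw [AlgHom.map_det, ← Matrix.det_one (n := ρ) (R := K)]
          congr 1
          ext i k
          change e (P (Sum.inl i) k) = _
          have he : e (X (Sum.inl (Sum.inr (Sum.inl i, k)))) =
              (if i = k then 1 else 0) - constantCoeff (N (Sum.inl i) (Sum.inl k)) := by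
            rw [AlgHom.comp_apply, killVars_X, if_neg]
            · simp [v, Sum.inl_injective.eq_iff]
            · intro h
              obtain ⟨a, -, ha⟩ := Finset.mem_map.1 h
              exact Sum.inr_ne_inl ha
          rw [hP, map_add, he, Matrix.one_apply, ← algebraMap_eq, AlgHom.commutes]
          simp
        rw [AlgHom.comp_apply, h0, map_zero] at h1
        exact zero_ne_one h1
      · have h2 : A.det • W = A.adjugate * (A * W) := by
          rw [← Matrix.mul_assoc, Matrix.adjugate_mul, Matrix.smul_mul, Matrix.one_mul]
        have h3 : A.det * X (Sum.inr (k, j)) = ∑ l, A.adjugate k l * Y (Sum.inl l) (Sum.inr j) := by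
          exact congr_fun₂ h2 k j
        change A.det * X (Sum.inr (k, j)) ∈ _
        rw [h3]
        refine sum_mem fun l _ => mul_mem ?_ (hYr _ _)
        choose A' hA' using fun i k => hYr (Sum.inl i) (Sum.inl k)
        have h4 : A = T.val.toRingHom.mapMatrix (Matrix.of A') := by
          ext1 i k
          exact (hA' i k).symm
        rw [h4, ← RingHom.map_adjugate]
        exact ⟨_, rfl⟩
    · rintro ((i | ⟨i, k⟩) | a) ha
      · simpa [gen] using hTr (X (Sum.inl i))
      · have : (X (Sum.inl (Sum.inr (i, k))) : MvPolynomial σ K) =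
            Y i (Sum.inl k) - C (constantCoeff (N i (Sum.inl k))) := by simp [hYinl, hP]
        rw [this]
        refine sub_mem (hYr _ _) ?_
        simpa [algebraMap_eq] using hTr (C (constantCoeff (N i (Sum.inl k))))
      · exact absurd (Finset.mem_map_of_mem Function.Embedding.inr (Finset.mem_univ a)) ha
  -- the locus where the generic matrix of corank two agrees with `N`
  let xT : ι → T := fun i => ψ (X (Sum.inl i))
  let YT : Matrix κ κ T := fun i j => ψ (X (Sum.inr (i, j)))
  have hYTv : ∀ i j, (YT i j : MvPolynomial σ K) = Y i j := fun i j => by simp [YT, hψv, gen]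
  let g : κ × κ → T := fun p => YT p.1 p.2 - aeval xT (N p.1 p.2)
  have hle : Ideal.span (Set.range g) ≤ 𝔪 := by
    rw [Ideal.span_le]
    rintro _ ⟨⟨i, j⟩, rfl⟩
    have h1 : constantCoeff ((aeval xT (N i j) : T) : MvPolynomial σ K) =
        constantCoeff (N i j) := by
      have : ((constantCoeff : MvPolynomial σ K →+* K).comp T.val.toRingHom).comp
          (aeval xT : MvPolynomial ι K →ₐ[K] T).toRingHom = constantCoeff := by
        ext a
        · simp
        · simp [xT, hψv, gen]
      exact DFunLike.congr_fun this _
    have : constantCoeff ((g (i, j) : T) : MvPolynomial σ K) = 0 := by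
      simp only [g, AddSubgroupClass.coe_sub, map_sub, h1, hYTv, hYc, sub_self]
    exact this
  obtain ⟨q, hq, hqm⟩ := Ideal.exists_minimalPrimes_le hle
  have hqp : q.IsPrime := hq.isPrime
  have : IsDomain (T ⧸ q) := Ideal.Quotient.isDomain q
  have : Nontrivial (T ⧸ q) := IsDomain.toNontrivial
  let π : T →ₐ[K] T ⧸ q := Ideal.Quotient.mkₐ K q
  have hπ : ∀ t, π t = 0 ↔ t ∈ q := fun t => Ideal.Quotient.eq_zero_iff_mem
  have hπN : N.map (aeval fun i => π (xT i)) = π.mapMatrix YT := by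
    ext i j
    have h1 : g (i, j) ∈ q := hq.1.2 (Ideal.subset_span ⟨_, rfl⟩)
    rw [← hπ, map_sub, sub_eq_zero] at h1
    have h2 : (aeval fun i => π (xT i)) (N i j) = π (aeval xT (N i j)) := by
      rw [← comp_aeval_apply]
    rw [Matrix.map_apply, h2, ← h1]
    rfl
  refine ⟨T ⧸ q, inferInstance, inferInstance, inferInstance, fun i => π (xT i), ?_, ?_⟩
  · intro h0
    have hmq : 𝔪 ≤ q := by
      intro t ht
      obtain ⟨p, rfl⟩ := hψ t
      let v : ι ⊕ κ × κ → K := Sum.elim 0 fun p => constantCoeff (N p.1 p.2)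
      have h1 : π.comp ψ = (Algebra.ofId K (T ⧸ q)).comp (aeval v) := by
        ext1 a
        rcases a with i | ⟨i, j⟩
        · simpa [v] using congr_fun h0 i
        · have h3 : π (YT i j) = aeval (0 : ι → T ⧸ q) (N i j) := by
            rw [← h0]
            exact (congr_fun₂ hπN i j).symm
          rw [aeval_zero] at h3
          rw [AlgHom.comp_apply, AlgHom.comp_apply, aeval_X]
          exact h3
      have h2 : aeval v p = 0 := by
        have : constantCoeff (ψ p : MvPolynomial σ K) = aeval v p := by
          have h3 : (constantCoeff : MvPolynomial σ K →+* K).comp (aeval gen).toRingHom =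
              (aeval v : MvPolynomial (ι ⊕ κ × κ) K →ₐ[K] K).toRingHom := by
            ext a
            · simp
            · rcases a with i | ⟨i, j⟩
              · simp [gen, v]
              · simp [gen, v, hYc]
          exact DFunLike.congr_fun h3 p
        rw [← this]
        exact ht
      rw [← hπ]
      have := DFunLike.congr_fun h1 p
      rwa [AlgHom.comp_apply, AlgHom.comp_apply, h2, map_zero] at this
    obtain rfl : q = 𝔪 := le_antisymm hqm hmq
    have h1 := hheight.trans (Ideal.height_le_card_of_mem_minimalPrimes_span (Set.finite_range g) hq)
    have h2 : (Set.range g).ncard ≤ Fintype.card (κ × κ) := by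
      rw [← Set.image_univ, ← Nat.card_eq_fintype_card, ← Set.ncard_univ]
      exact Set.ncard_image_le
    have h3 : Fintype.card σ ≤ Fintype.card (κ × κ) := le_trans (by exact_mod_cast h1) h2
    simp only [σ, κ, Fintype.card_sum, Fintype.card_prod, Fintype.card_fin] at h3
    nlinarith
  · rw [hπN, ← AlgHom.map_adjugate]
    have : YT.adjugate = 0 := by
      have h1 : T.val.mapMatrix YT = Y := by
        ext1 i j
        exact hYTv i j
      have h2 : T.val.mapMatrix YT.adjugate = 0 := by rw [AlgHom.map_adjugate, h1, hYadj]
      ext1 i j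
      exact Subtype.ext (congr_fun₂ h2 i j)
    rw [this, map_zero]

/-- The singular locus of a determinantal Fermat hypersurface is the origin. -/
theorem MvPolynomial.eq_zero_of_adjugate_eq_zero {K ι κ B : Type*} [Field K] [CharZero K]
    [Fintype ι] [Fintype κ] [DecidableEq κ] [CommRing B] [IsDomain B] [Algebra K B]
    {d : ℕ} (hd : 2 ≤ d) {c : K} (hc : c ≠ 0) {N : Matrix κ κ (MvPolynomial ι K)}
    (hdet : N.det = C c * ∑ i, X i ^ d) {x : ι → B} (hx : (N.map (aeval x)).adjugate = 0) :
    x = 0 := by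
  classical
  have hadj : ∀ i j, aeval x (N.adjugate i j) = 0 := by
    intro i j
    have h : (aeval x : MvPolynomial ι K →ₐ[K] B).mapMatrix N.adjugate = 0 := by
      rw [AlgHom.map_adjugate]
      exact hx
    exact congr_fun₂ h i j
  funext i
  have h1 : aeval x (pderiv i N.det) = 0 := by
    rw [Derivation.map_matrix_det, map_sum]
    refine Finset.sum_eq_zero fun k _ => ?_
    simp [Matrix.mulVec, dotProduct, hadj]
  have h2 : pderiv i N.det = C c * ((d : MvPolynomial ι K) * X i ^ (d - 1)) := by
    rw [hdet, pderiv_C_mul, map_sum, Finset.sum_eq_single i]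
    · simp
    · intro j _ hj
      simp [pderiv_X_of_ne hj]
    · simp
  have hd0 : (algebraMap K B d) ≠ 0 := by
    rw [Ne, FaithfulSMul.algebraMap_eq_zero_iff]
    exact_mod_cast (by omega : d ≠ 0)
  have hc0 : algebraMap K B c ≠ 0 := by rwa [Ne, FaithfulSMul.algebraMap_eq_zero_iff]
  rw [h2] at h1
  rw [map_natCast] at hd0
  simp only [map_mul, map_pow, map_natCast, aeval_X, aeval_C] at h1
  exact eq_zero_of_pow_eq_zero (by simpa [hc0, hd0] using h1)

/-- A square matrix of corank at least two has two zero columns after a change of basis. -/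
theorem Matrix.exists_mul_apply_inr_eq_zero {K ρ : Type*} [Field K] [Fintype ρ] [DecidableEq ρ]
    (A : Matrix (ρ ⊕ Fin 2) (ρ ⊕ Fin 2) K) (hA : A.rank ≤ Fintype.card ρ) :
    ∃ G : Matrix (ρ ⊕ Fin 2) (ρ ⊕ Fin 2) K, G.det ≠ 0 ∧ ∀ i j, (A * G) i (Sum.inr j) = 0 := by
  have hker : 2 ≤ Module.finrank K (LinearMap.ker A.mulVecLin) := by
    have h := A.mulVecLin.finrank_range_add_finrank_ker
    rw [← Matrix.rank, Module.finrank_fintype_fun_eq_card, Fintype.card_sum, Fintype.card_fin] at h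
    omega
  obtain ⟨f, hf⟩ := exists_linearIndependent_of_le_finrank hker
  have hf' : LinearIndependent K fun i => (f i : ρ ⊕ Fin 2 → K) :=
    hf.map' _ (Submodule.ker_subtype _)
  let b := Module.Basis.sumExtend hf'
  have := Module.Finite.finite_basis b
  have : Finite (Module.Basis.sumExtendIndex hf') :=
    Finite.of_injective (Sum.inr (α := Fin 2)) Sum.inr_injective
  have := Fintype.ofFinite (Module.Basis.sumExtendIndex hf')
  have hcard : Fintype.card (Module.Basis.sumExtendIndex hf') = Fintype.card ρ := by
    have := Module.finrank_eq_card_basis b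
    rw [Module.finrank_fintype_fun_eq_card, Fintype.card_sum, Fintype.card_sum,
      Fintype.card_fin] at this
    omega
  let e := Fintype.equivOfCardEq hcard
  let b' := b.reindex ((Equiv.sumComm _ _).trans (e.sumCongr (Equiv.refl _)))
  have hb' : ∀ j, b' (Sum.inr j) = f j := by
    intro j
    simp only [b', b, Module.Basis.sumExtend, Module.Basis.reindex_apply,
      Module.Basis.extend_apply_self]
    rfl
  refine ⟨(Pi.basisFun K (ρ ⊕ Fin 2)).toMatrix b', ?_, ?_⟩
  · rw [← Module.Basis.det_apply]
    exact ((Pi.basisFun K (ρ ⊕ Fin 2)).isUnit_det b').ne_zero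
  · intro i j
    have h : A.mulVec (f j) = 0 := (f j).2
    have h' := congr_fun h i
    rw [← hb' j] at h'
    simpa [Matrix.mul_apply, Matrix.mulVec, dotProduct, Module.Basis.toMatrix_apply] using h'

/-- If `det M = ∑_{i=1}^n x_i^d` with `d ≥ 2` and `n ≥ 5`, then the
constant part `M(0) ∈ ℂ^{m×m}` has rank exactly `m - 1`. -/
theorem rank_of_constant_part (n d m : ℕ) (hd : 2 ≤ d) (hn : 5 ≤ n)
    (M : Matrix (Fin m) (Fin m) (MvPolynomial (Fin n) ℂ))
    (hdet : M.det = ∑ i : Fin n, X i ^ d) :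
    (M.map (eval (0 : Fin n → ℂ))).rank = m - 1 := by
  have hzero : (M.map (eval (0 : Fin n → ℂ))).det = 0 := by
    have h : (M.map (eval (0 : Fin n → ℂ))).det = eval 0 M.det := by
      rw [RingHom.map_det]
      rfl
    rw [h, hdet, map_sum]
    exact Finset.sum_eq_zero fun i _ => by simp [show d ≠ 0 by omega]
  have hlt : (M.map (eval (0 : Fin n → ℂ))).rank < m := by
    obtain ⟨v, hv0, hv⟩ := Matrix.exists_mulVec_eq_zero_iff.2 hzero
    have h := (M.map (eval (0 : Fin n → ℂ))).mulVecLin.finrank_range_add_finrank_ker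
    rw [← Matrix.rank, Module.finrank_fin_fun] at h
    have hpos : 0 < Module.finrank ℂ
        (LinearMap.ker (M.map (eval (0 : Fin n → ℂ))).mulVecLin) :=
      Module.finrank_pos_iff_exists_ne_zero.2 ⟨⟨v, hv⟩, fun h0 => hv0 (congrArg Subtype.val h0)⟩
    omega
  by_contra hne
  obtain ⟨r, rfl⟩ : ∃ r, m = r + 2 := ⟨m - 2, by omega⟩
  let e : Fin (r + 2) ≃ Fin r ⊕ Fin 2 := finSumFinEquiv.symm
  let M' := M.submatrix e.symm e.symm
  obtain ⟨G, hG, hG0⟩ := Matrix.exists_mul_apply_inr_eq_zero (M'.map (eval (0 : Fin n → ℂ))) (by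
    change ((M.map (eval (0 : Fin n → ℂ))).submatrix e.symm e.symm).rank ≤ _
    rw [Matrix.rank_submatrix, Fintype.card_fin]
    omega)
  obtain ⟨B, _, _, _, x, hx, hadj⟩ := MvPolynomial.exists_ne_zero_adjugate_eq_zero
    (K := ℂ) (by simpa using hn) (M' * G.map C) (by
      intro i j
      have h := hG0 i j
      rw [Matrix.mul_apply] at h ⊢
      simpa only [map_sum, map_mul, Matrix.map_apply, constantCoeff_C, eval_zero] using h)
  refine hx (MvPolynomial.eq_zero_of_adjugate_eq_zero hd hG ?_ hadj)
  have hGC : (G.map C : Matrix _ _ (MvPolynomial (Fin n) ℂ)).det = C G.det := by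
    rw [RingHom.map_det]
    rfl
  rw [Matrix.det_mul, Matrix.det_submatrix_equiv_self, hdet, hGC, mul_comm]
end

section
/- Let d ≥ 2 be a natural number and let M be an m × m matrix of polynomials in ℂ[x_1, ..., x_n] such that every entry of M has degree at most d − 1, and the constant part M(0) is a diagonal matrix with (M(0))_{1,1} = 0 and (M(0))_{i,i} = 1 for all 2 ≤ i ≤ m. Suppose det(M) = (∑_{i=1}^n x_i^d) · (β + Q), where β ∈ ℂ is nonzero and Q ∈ ℂ[x_1, ..., x_n] satisfies Q(0) = 0. Then 2m ≥ n − 2 (i.e., m ≥ n/2 − 1). -/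
open MvPolynomial

theorem MvPolynomial.natCast_le_height_ker_eval_zero (n : ℕ) :
    (n : ℕ∞) ≤ (RingHom.ker (eval (0 : Fin n → ℂ))).height := by
  let φ : ℕ → MvPolynomial (Fin n) ℂ →ₐ[ℂ] MvPolynomial (Fin n) ℂ := fun k ↦
    aeval fun j ↦ if j.val < k then 0 else X j
  have hprime : ∀ k, (RingHom.ker (φ k)).IsPrime := fun k ↦ RingHom.ker_isPrime _
  have hcomp : ∀ k, (φ (k + 1)).comp (φ k) = φ (k + 1) := by
    intro k
    apply algHom_ext
    intro j
    simp only [φ, AlgHom.comp_apply, aeval_X]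
    split_ifs with h1 h2 h2 <;> simp <;> omega
  have hlt : ∀ k < n, RingHom.ker (φ k) < RingHom.ker (φ (k + 1)) := by
    intro k hk
    refine lt_of_le_of_ne (fun p hp ↦ ?_) fun h ↦ ?_
    · rw [RingHom.mem_ker] at hp ⊢
      rw [← hcomp k, AlgHom.comp_apply, hp, map_zero]
    · have : X ⟨k, hk⟩ ∈ RingHom.ker (φ k) := by
        rw [h, RingHom.mem_ker]; simp [φ]
      rw [RingHom.mem_ker] at this
      simp [φ] at this
  have hheight : ∀ k ≤ n, (k : ℕ∞) ≤ (RingHom.ker (φ k)).height := by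
    intro k
    induction k with
    | zero => simp
    | succ k ih =>
      intro hk
      push_cast
      exact (add_le_add_left (ih (by omega)) 1).trans
        (Ideal.height_add_one_le_of_lt_of_isPrime (hlt k (by omega)))
  refine (hheight n le_rfl).trans (Ideal.height_mono fun p hp ↦ ?_)
  rw [RingHom.mem_ker] at hp ⊢
  have h : (aeval (0 : Fin n → ℂ)).comp (φ n) = aeval (0 : Fin n → ℂ) := by
    apply algHom_ext
    intro j
    simp [φ]
  have h2 := congrArg (aeval (0 : Fin n → ℂ)) hp
  rw [← AlgHom.comp_apply, h, map_zero] at h2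
  simpa [aeval_eq_eval] using h2

theorem MvPolynomial.totalDegree_pderiv_lt_s8 {σ R : Type*} [CommRing R] {e : ℕ} (he : 0 < e)
    (p : MvPolynomial σ R) (hp : p.totalDegree ≤ e) (i : σ) :
    (pderiv i p).totalDegree < e := by
  classical
  rw [p.as_sum, map_sum]
  refine (totalDegree_finsetSum_le (d := e - 1) fun s hs ↦ ?_).trans_lt (by omega)
  rw [pderiv_monomial]
  by_cases hsi : s i = 0
  · simp [hsi]
  · refine (totalDegree_monomial_le _ _).trans ?_
    have h1 := (le_totalDegree hs).trans hp
    have h2 : Finsupp.single i 1 ≤ s := by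
      rw [Finsupp.single_le_iff]; omega
    have h3 := congrArg Finsupp.degree (tsub_add_cancel_of_le h2)
    rw [map_add, Finsupp.degree_single] at h3
    change Finsupp.degree s ≤ e at h1
    change Finsupp.degree _ ≤ e - 1
    omega

theorem MvPolynomial.isMaximal_of_X_pow_sub_mem {n e : ℕ} (P : Ideal (MvPolynomial (Fin n) ℂ))
    [P.IsPrime] (q : Fin n → MvPolynomial (Fin n) ℂ) (hq : ∀ i, (q i).totalDegree < e)
    (hP : ∀ i, X i ^ e - q i ∈ P) : P.IsMaximal := by
  classical
  let W := restrictTotalDegree (Fin n) ℂ (n * e) ⊔ P.restrictScalars ℂ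
  have hW : ∀ D (p : MvPolynomial (Fin n) ℂ), p.totalDegree < D → p ∈ W := by
    intro D
    induction D with
    | zero => intro p hp; omega
    | succ D ih =>
      intro p hp
      rw [p.as_sum]
      refine Submodule.sum_mem _ fun s hs ↦ ?_
      have hsD : s.degree ≤ D := (le_totalDegree hs).trans (by omega)
      by_cases hsN : s.degree ≤ n * e
      · refine Submodule.mem_sup_left ?_
        rw [mem_restrictTotalDegree]
        exact (totalDegree_monomial_le _ _).trans hsN
      · obtain ⟨i, hi⟩ : ∃ i, e ≤ s i := by
          by_contra! h
          apply hsN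
          rw [Finsupp.degree_eq_sum]
          calc ∑ i, s i ≤ ∑ _i : Fin n, e := Finset.sum_le_sum fun i _ ↦ (h i).le
            _ = n * e := by simp
        have h2 : Finsupp.single i e ≤ s := by rwa [Finsupp.single_le_iff]
        have h4 := tsub_add_cancel_of_le h2
        have h3 := congrArg Finsupp.degree h4
        rw [map_add, Finsupp.degree_single] at h3
        have h5 : monomial s (coeff s p) =
            monomial (s - Finsupp.single i e) (coeff s p) * q i +
            monomial (s - Finsupp.single i e) (coeff s p) * (X i ^ e - q i) := by
          rw [← mul_add, add_sub_cancel, X_pow_eq_monomial, monomial_mul, h4, mul_one]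
        rw [h5]
        refine add_mem (ih _ ?_) (Submodule.mem_sup_right (P.mul_mem_left _ (hP i)))
        refine (totalDegree_mul _ _).trans_lt ?_
        have h6 : (monomial (s - Finsupp.single i e) (coeff s p)).totalDegree ≤
          (s - Finsupp.single i e).degree := totalDegree_monomial_le _ _
        have := hq i
        omega
  have hsurj : Function.Surjective ((Ideal.Quotient.mkₐ ℂ P).toLinearMap.comp
      (restrictTotalDegree (Fin n) ℂ (n * e)).subtype) := by
    intro y
    obtain ⟨p, rfl⟩ := Ideal.Quotient.mk_surjective y
    obtain ⟨r, hr, t, ht, rfl⟩ := Submodule.mem_sup.mp (hW _ p (Nat.lt_succ_self _))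
    refine ⟨⟨r, hr⟩, ?_⟩
    have : Ideal.Quotient.mk P t = 0 := Ideal.Quotient.eq_zero_iff_mem.mpr ht
    simp [this]
  have := Module.Finite.of_surjective _ hsurj
  exact Ideal.Quotient.maximal_of_isField _
    (isField_of_isIntegral_of_isField' (R := ℂ) (Field.toIsField ℂ))

theorem Matrix.det_sub_mul_det_submatrix_mem_mul {R : Type*} [CommRing R] {k : ℕ}
    (A : Matrix (Fin (k + 1)) (Fin (k + 1)) R) (P : Ideal R) (hrow : ∀ j : Fin k, A 0 j.succ ∈ P)
    (hcol : ∀ j : Fin k, A j.succ 0 ∈ P) :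
    A.det - A 0 0 * (A.submatrix Fin.succ Fin.succ).det ∈ P * P := by
  rw [Matrix.det_succ_row_zero, Fin.sum_univ_succ]
  have hsucc : Fin.succAbove (0 : Fin (k + 1)) = Fin.succ := by ext; simp
  simp only [Fin.val_zero, pow_zero, one_mul, hsucc, add_sub_cancel_left]
  refine Ideal.sum_mem _ fun j _ ↦ Ideal.mul_mem_mul (P.mul_mem_left _ (hrow j)) ?_
  cases k with
  | zero => exact j.elim0
  | succ k =>
    rw [Matrix.det_succ_column_zero]
    refine Ideal.sum_mem _ fun i _ ↦ P.mul_mem_right _ (P.mul_mem_left _ ?_)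
    simpa using hcol i

theorem MvPolynomial.pderiv_mem_of_mem_mul {σ R : Type*} [CommRing R]
    {P : Ideal (MvPolynomial σ R)} {p : MvPolynomial σ R} (hp : p ∈ P * P) (i : σ) :
    pderiv i p ∈ P := by
  induction hp using Submodule.mul_induction_on' with
  | mem_mul_mem a ha b hb =>
    rw [pderiv_mul]
    exact add_mem (P.mul_mem_left _ hb) (P.mul_mem_right _ ha)
  | add a _ b _ iha ihb =>
    rw [map_add]
    exact add_mem iha ihb

/-- Lower bound for higher-degree determinantal representations.
Let `d ≥ 2`, and let `M` be an `m × m` matrix of polynomials of degree at most `d - 1`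
whose constant part `M(0)` is diagonal with `(M(0))_{1,1} = 0` and `(M(0))_{i,i} = 1`
for `2 ≤ i ≤ m`. If `det M = (∑_{i=1}^n x_i^d) ⬝ (β + Q)` with `β ≠ 0` and `Q(0) = 0`,
then `2m ≥ n - 2`. -/
theorem higher_degree_lower_bound (n d m : ℕ) (hd : 2 ≤ d)
    (M : Matrix (Fin m) (Fin m) (MvPolynomial (Fin n) ℂ))
    (hdeg : ∀ i j, (M i j).totalDegree ≤ d - 1)
    (hoffdiag : ∀ i j, i ≠ j → eval (0 : Fin n → ℂ) (M i j) = 0)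
    (hdiag0 : ∀ i : Fin m, i.val = 0 → eval (0 : Fin n → ℂ) (M i i) = 0)
    (hdiag1 : ∀ i : Fin m, i.val ≠ 0 → eval (0 : Fin n → ℂ) (M i i) = 1)
    (β : ℂ) (hβ : β ≠ 0) (Q : MvPolynomial (Fin n) ℂ) (hQ : eval (0 : Fin n → ℂ) Q = 0)
    (hdet : M.det = (∑ i : Fin n, X i ^ d) * (C β + Q)) :
    2 * m ≥ n - 2 := by
  rcases m with _ | k
  · have h := congrArg (eval (0 : Fin n → ℂ)) hdet
    have hd0 : d ≠ 0 := by omega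
    simp [hd0] at h
  set w := (M.submatrix Fin.succ Fin.succ).det with hw
  set u := C β + Q with hu
  set f : MvPolynomial (Fin n) ℂ := ∑ i : Fin n, X i ^ d with hf
  let S : Set (MvPolynomial (Fin n) ℂ) :=
    insert (C β * w - u) (Set.range (M 0) ∪ Set.range fun j : Fin k ↦ M j.succ 0)
  have hScard : S.ncard ≤ 2 * (k + 1) := by
    have h1 : (Set.range (M 0)).ncard ≤ k + 1 := by
      simpa [Set.image_univ, Set.ncard_univ] using Set.ncard_image_le (f := M 0) Set.finite_univ
    have h2 : (Set.range fun j : Fin k ↦ M j.succ 0).ncard ≤ k := by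
      simpa [Set.image_univ, Set.ncard_univ] using
        Set.ncard_image_le (f := fun j : Fin k ↦ M j.succ 0) Set.finite_univ
    have h3 := Set.ncard_union_le (Set.range (M 0)) (Set.range fun j : Fin k ↦ M j.succ 0)
    have h4 := Set.ncard_insert_le (C β * w - u)
      (Set.range (M 0) ∪ Set.range fun j : Fin k ↦ M j.succ 0)
    change (insert _ _ : Set _).ncard ≤ _
    omega
  have hSfin : S.Finite := ((Set.finite_range _).union (Set.finite_range _)).insert _
  have hu0 : eval (0 : Fin n → ℂ) u = β := by rw [hu, map_add, eval_C, hQ, add_zero]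
  have hw0 : eval (0 : Fin n → ℂ) w = 1 := by
    rw [hw, RingHom.map_det, RingHom.mapMatrix_apply]
    rw [← Matrix.det_one (n := Fin k) (R := ℂ)]
    congr 1
    ext i j
    by_cases hij : i = j
    · subst hij
      rw [Matrix.one_apply_eq]
      exact hdiag1 i.succ (by simp)
    · rw [Matrix.one_apply_ne hij]
      exact hoffdiag i.succ j.succ (by simpa using hij)
  have hS : Ideal.span S ≤ RingHom.ker (eval (0 : Fin n → ℂ)) := by
    rw [Ideal.span_le]
    rintro _ (rfl | ⟨j, rfl⟩ | ⟨j, rfl⟩)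
    · rw [SetLike.mem_coe, RingHom.mem_ker, map_sub, map_mul, eval_C, hu0, hw0, mul_one, sub_self]
    · by_cases hj : (0 : Fin (k + 1)) = j
      · subst hj
        exact hdiag0 0 rfl
      · exact hoffdiag 0 j hj
    · exact hoffdiag j.succ 0 (Fin.succ_ne_zero j)
  have hmax : ∀ P : Ideal (MvPolynomial (Fin n) ℂ), P.IsPrime → Ideal.span S ≤ P →
      P ≤ RingHom.ker (eval (0 : Fin n → ℂ)) → P.IsMaximal := by
    intro P hPprime hSP hPle
    have hrow : ∀ j, M 0 j ∈ P := fun j ↦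
      hSP (Ideal.subset_span (Or.inr (Or.inl ⟨j, rfl⟩)))
    have hcol : ∀ j : Fin k, M j.succ 0 ∈ P := fun j ↦
      hSP (Ideal.subset_span (Or.inr (Or.inr ⟨j, rfl⟩)))
    have hwu : C β * w - u ∈ P := hSP (Ideal.subset_span (Or.inl rfl))
    have huP : u ∉ P := fun h ↦ hβ (by rw [← hu0]; exact hPle h)
    have hsq := M.det_sub_mul_det_submatrix_mem_mul P (fun j ↦ hrow j.succ) hcol
    rw [hdet, ← hw] at hsq
    have hfP : f ∈ P := by
      refine (hPprime.mem_or_mem ?_).resolve_right huP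
      rw [← sub_add_cancel (f * u) (M 0 0 * w)]
      exact add_mem (Ideal.mul_le_right hsq) (P.mul_mem_right _ (hrow 0))
    refine isMaximal_of_X_pow_sub_mem (e := d - 1) P
      (fun i ↦ C (β * d)⁻¹ * pderiv i (M 0 0)) (fun i ↦ ?_) fun i ↦ ?_
    · refine (totalDegree_mul _ _).trans_lt ?_
      rw [totalDegree_C, zero_add]
      exact totalDegree_pderiv_lt_s8 (by omega) _ (hdeg 0 0) i
    · have hder := pderiv_mem_of_mem_mul hsq i
      have hfder : pderiv i f = C (d : ℂ) * X i ^ (d - 1) := by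
        rw [hf, map_sum, Finset.sum_eq_single i]
        · simp
        · intro j _ hj
          simp [pderiv_X_of_ne hj]
        · simp
      rw [map_sub, pderiv_mul, pderiv_mul, hfder] at hder
      have hdC : (d : ℂ) ≠ 0 := by
        exact_mod_cast (by omega : d ≠ 0)
      refine (hPprime.mem_or_mem (x := u) ?_).resolve_left huP
      have hinv : (C (β * d)⁻¹ * C β * C (d : ℂ) : MvPolynomial (Fin n) ℂ) = 1 := by
        rw [← C_mul, ← C_mul, ← C_1]
        congr 1
        field_simp
      rw [← Ideal.Quotient.eq_zero_iff_mem] at hder hfP hwu ⊢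
      have ha := Ideal.Quotient.eq_zero_iff_mem.mpr (hrow 0)
      have hinv' := congrArg (Ideal.Quotient.mk P) hinv
      simp only [map_sub, map_add, map_mul, map_one] at hder hwu hinv' ⊢
      rw [hfP, ha] at hder
      linear_combination (Ideal.Quotient.mk P (C (β * d)⁻¹)) * (Ideal.Quotient.mk P (C β)) * hder
        - (Ideal.Quotient.mk P u * Ideal.Quotient.mk P (X i ^ (d - 1))) * hinv'
        + (Ideal.Quotient.mk P (C (β * d)⁻¹)) * (Ideal.Quotient.mk P (pderiv i (M 0 0))) * hwu
  have hmin : RingHom.ker (eval (0 : Fin n → ℂ)) ∈ (Ideal.span S).minimalPrimes := by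
    refine ⟨⟨RingHom.ker_isPrime _, hS⟩, fun P ⟨hP, hSP⟩ hle ↦ ?_⟩
    exact ((hmax P hP hSP hle).eq_of_le (RingHom.ker_isPrime _).ne_top hle).ge
  have hheight := (natCast_le_height_ker_eval_zero n).trans
    (Ideal.height_le_card_of_mem_minimalPrimes_span hSfin hmin)
  have hn : n ≤ S.ncard := by exact_mod_cast hheight
  omega
end

section
/- Let n ≥ 2 and let M be an m × m matrix over ℂ[x_1, ..., x_n] whose entries are polynomials of degree at most 1, with m ≥ n, such that det(M) = ∑_{i=1}^n x_i^n and the constant part M(0) is a diagonal matrix with (M(0))_{1,1} = 0 and (M(0))_{i,i} = 1 for 2 ≤ i ≤ m. Then there exists an (m − n + 2) × (m − n + 2) matrix N of polynomials in ℂ[x_1, ..., x_n], each of degree at most n − 1, and a polynomial R ∈ ℂ[x_1, ..., x_n] with R(0) = 0, such that det(N) = (∑_{i=1}^n x_i^n) · (1 + R)^{m−n+1}, and the constant part N(0) is a diagonal matrix with (N(0))_{1,1} = 0 and (N(0))_{i,i} = 1 for all 2 ≤ i ≤ m − n + 2. -/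
open MvPolynomial

theorem MvPolynomial.totalDegree_det_le_s9 {σ R ι : Type*} [CommRing R] [Fintype ι] [DecidableEq ι]
    (D : Matrix ι ι (MvPolynomial σ R)) (d : ℕ) (hD : ∀ i j, (D i j).totalDegree ≤ d) :
    D.det.totalDegree ≤ Fintype.card ι * d := by
  rw [Matrix.det_apply]
  refine totalDegree_finsetSum_le fun τ _ => ?_
  have hprod : (∏ i, D (τ i) i).totalDegree ≤ Fintype.card ι * d :=
    (totalDegree_finsetProd _ _).trans <|
      (Finset.sum_le_sum fun i _ => hD (τ i) i).trans (by simp)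
  rcases Int.units_eq_one_or (Equiv.Perm.sign τ) with h | h
  · simpa [h] using hprod
  · simpa [h] using hprod

theorem MvPolynomial.totalDegree_adjugate_add_one_le {σ R : Type*} [CommRing R] {l : ℕ}
    (D : Matrix (Fin l) (Fin l) (MvPolynomial σ R)) (hD : ∀ i j, (D i j).totalDegree ≤ 1)
    (i j : Fin l) : (D.adjugate i j).totalDegree + 1 ≤ l := by
  obtain _ | l := l
  · exact i.elim0
  rw [Matrix.adjugate_fin_succ_eq_det_submatrix]
  have hdet := totalDegree_det_le_s9 (D.submatrix j.succAbove i.succAbove) 1 fun _ _ => hD _ _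
  rw [Fintype.card_fin, mul_one] at hdet
  rcases neg_one_pow_eq_or (MvPolynomial σ R) (j + i : ℕ) with h | h
  · simpa [h] using hdet
  · simpa [h] using hdet

namespace Matrix

/-- The Schur complement of a block matrix with respect to its lower-right block, multiplied by
the determinant of that block. -/
def clearedSchur {ι κ S : Type*} [Fintype κ] [DecidableEq κ] [CommRing S]
    (A : Matrix ι ι S) (B : Matrix ι κ S) (C : Matrix κ ι S) (D : Matrix κ κ S) :
    Matrix ι ι S :=
  D.det • A - B * D.adjugate * C

theorem det_clearedSchur_mul_det {ι κ S : Type*} [Fintype ι] [DecidableEq ι] [Fintype κ]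
    [DecidableEq κ] [CommRing S]
    (A : Matrix ι ι S) (B : Matrix ι κ S) (C : Matrix κ ι S) (D : Matrix κ κ S) :
    (clearedSchur A B C D).det * D.det =
      (fromBlocks A B C D).det * D.det ^ Fintype.card ι := by
  have h : fromBlocks A B C D * fromBlocks (D.det • 1) 0 (-(D.adjugate * C)) 1 =
      fromBlocks (clearedSchur A B C D) B 0 D := by
    rw [fromBlocks_multiply]
    congr 1 <;> simp [clearedSchur, sub_eq_add_neg, Matrix.mul_assoc]
    rw [← Matrix.mul_assoc, mul_adjugate]
    simp
  have h' := congrArg det h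
  rw [det_mul, det_fromBlocks_zero₁₂, det_fromBlocks_zero₂₁, det_smul, det_one, det_one, mul_one,
    mul_one] at h'
  exact h'.symm

theorem map_clearedSchur {ι κ S T : Type*} [Fintype κ] [DecidableEq κ] [CommRing S] [CommRing T]
    (f : S →+* T) (A : Matrix ι ι S) (B : Matrix ι κ S) (C : Matrix κ ι S) (D : Matrix κ κ S) :
    (clearedSchur A B C D).map f =
      clearedSchur (A.map f) (B.map f) (C.map f) (D.map f) := by
  have hdet : (D.map f).det = f D.det := (f.map_det D).symm
  have hadj : (D.map f).adjugate = D.adjugate.map f := (f.map_adjugate D).symm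
  rw [clearedSchur, clearedSchur, hdet, hadj, ← Matrix.map_mul, ← Matrix.map_mul]
  ext i j
  simp only [map_apply, sub_apply, smul_apply, smul_eq_mul, map_sub, map_mul]

@[simp]
theorem clearedSchur_zero_one {ι κ S : Type*} [Fintype κ] [DecidableEq κ] [CommRing S]
    (A : Matrix ι ι S) (C : Matrix κ ι S) : clearedSchur A 0 C 1 = A := by
  simp [clearedSchur]

theorem totalDegree_clearedSchur_le {σ R ι : Type*} [CommRing R] {l : ℕ}
    (A : Matrix ι ι (MvPolynomial σ R)) (B : Matrix ι (Fin l) (MvPolynomial σ R))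
    (C : Matrix (Fin l) ι (MvPolynomial σ R)) (D : Matrix (Fin l) (Fin l) (MvPolynomial σ R))
    (hA : ∀ i j, (A i j).totalDegree ≤ 1) (hB : ∀ i j, (B i j).totalDegree ≤ 1)
    (hC : ∀ i j, (C i j).totalDegree ≤ 1) (hD : ∀ i j, (D i j).totalDegree ≤ 1) (i j : ι) :
    (clearedSchur A B C D i j).totalDegree ≤ l + 1 := by
  rw [clearedSchur, sub_apply, smul_apply, smul_eq_mul, mul_apply]
  refine (totalDegree_sub _ _).trans (max_le ?_ ?_)
  · have hdet := totalDegree_det_le_s9 D 1 hD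
    rw [Fintype.card_fin, mul_one] at hdet
    exact (totalDegree_mul _ _).trans (add_le_add hdet (hA i j))
  · refine totalDegree_finsetSum_le fun q _ => ?_
    rw [mul_apply]
    refine (totalDegree_mul _ _).trans (add_le_add ?_ (hC q j))
    refine totalDegree_finsetSum_le fun p _ => (totalDegree_mul _ _).trans ?_
    have := totalDegree_adjugate_add_one_le D hD p q
    have := hB i p
    omega

end Matrix

/-- Trading dimension for degree. If `M` is an `m × m` matrix of affine
entries in normal form with `det M = ∑_{i=1}^n x_i^n`, `m ≥ n`, `n ≥ 2`, then there is an
`(m - n + 2) × (m - n + 2)` matrix `N` of polynomials of degree at most `n - 1`, in normal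
form, and a constant-free polynomial `R`, with
`det N = (∑_{i=1}^n x_i^n) ⬝ (1 + R)^(m - n + 1)`. -/
theorem trading_dimension_for_degree (n m : ℕ) (hn : 2 ≤ n) (hm : n ≤ m)
    (M : Matrix (Fin m) (Fin m) (MvPolynomial (Fin n) ℂ))
    (hdeg : ∀ i j, (M i j).totalDegree ≤ 1)
    (hdet : M.det = ∑ i : Fin n, X i ^ n)
    (hoffdiag : ∀ i j, i ≠ j → eval (0 : Fin n → ℂ) (M i j) = 0)
    (hdiag0 : ∀ i : Fin m, i.val = 0 → eval (0 : Fin n → ℂ) (M i i) = 0)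
    (hdiag1 : ∀ i : Fin m, i.val ≠ 0 → eval (0 : Fin n → ℂ) (M i i) = 1) :
    ∃ (N : Matrix (Fin (m - n + 2)) (Fin (m - n + 2)) (MvPolynomial (Fin n) ℂ))
      (R : MvPolynomial (Fin n) ℂ),
      eval (0 : Fin n → ℂ) R = 0 ∧
      (∀ i j, (N i j).totalDegree ≤ n - 1) ∧
      N.det = (∑ i : Fin n, X i ^ n) * (1 + R) ^ (m - n + 1) ∧
      (∀ i j, i ≠ j → eval (0 : Fin n → ℂ) (N i j) = 0) ∧
      (∀ i : Fin (m - n + 2), i.val = 0 → eval (0 : Fin n → ℂ) (N i i) = 0) ∧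
      (∀ i : Fin (m - n + 2), i.val ≠ 0 → eval (0 : Fin n → ℂ) (N i i) = 1) := by
  obtain ⟨l, rfl⟩ : ∃ l, n = l + 2 := ⟨n - 2, by omega⟩
  have hsize : m - (l + 2) + 2 + l = m := by omega
  let e : Fin (m - (l + 2) + 2) ⊕ Fin l ≃ Fin m := finSumFinEquiv.trans (finCongr hsize)
  have he_inl (i) : (e (.inl i)).val = i.val := by simp [e]
  have he_inr (i) : (e (.inr i)).val = m - (l + 2) + 2 + i.val := by simp [e]
  let P := M.submatrix e e
  have hB (i j) : eval (0 : Fin (l + 2) → ℂ) (P.toBlocks₁₂ i j) = 0 :=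
    hoffdiag _ _ (e.injective.ne Sum.inl_ne_inr)
  have hB0 : P.toBlocks₁₂.map (eval (0 : Fin (l + 2) → ℂ)) = 0 := Matrix.ext hB
  have hD0 : P.toBlocks₂₂.map (eval (0 : Fin (l + 2) → ℂ)) = 1 := by
    ext i j
    obtain rfl | hij := eq_or_ne i j
    · rw [Matrix.one_apply_eq]
      exact hdiag1 (e (.inr i)) (by rw [he_inr]; omega)
    · rw [Matrix.one_apply_ne hij]
      exact hoffdiag _ _ (e.injective.ne (Sum.inr_injective.ne hij))
  have hdetD : eval (0 : Fin (l + 2) → ℂ) P.toBlocks₂₂.det = 1 := by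
    rw [RingHom.map_det, RingHom.mapMatrix_apply, hD0, Matrix.det_one]
  let N := Matrix.clearedSchur P.toBlocks₁₁ P.toBlocks₁₂ P.toBlocks₂₁ P.toBlocks₂₂
  have hN (i j) : eval (0 : Fin (l + 2) → ℂ) (N i j) =
      eval (0 : Fin (l + 2) → ℂ) (M (e (.inl i)) (e (.inl j))) := by
    have h := Matrix.map_clearedSchur (eval (0 : Fin (l + 2) → ℂ))
      P.toBlocks₁₁ P.toBlocks₁₂ P.toBlocks₂₁ P.toBlocks₂₂
    rw [hB0, hD0, Matrix.clearedSchur_zero_one] at h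
    exact congrFun₂ h i j
  refine ⟨N, P.toBlocks₂₂.det - 1, by rw [map_sub, hdetD, map_one, sub_self], ?_, ?_, ?_, ?_, ?_⟩
  · exact Matrix.totalDegree_clearedSchur_le _ _ _ _ (fun _ _ => hdeg _ _) (fun _ _ => hdeg _ _)
      (fun _ _ => hdeg _ _) (fun _ _ => hdeg _ _)
  · have hne : P.toBlocks₂₂.det ≠ 0 := fun h => by simp [h] at hdetD
    have h := Matrix.det_clearedSchur_mul_det
      P.toBlocks₁₁ P.toBlocks₁₂ P.toBlocks₂₁ P.toBlocks₂₂
    rw [Matrix.fromBlocks_toBlocks, Matrix.det_submatrix_equiv_self, hdet, Fintype.card_fin,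
      pow_succ, ← mul_assoc] at h
    rw [add_sub_cancel]
    exact mul_right_cancel₀ hne h
  · exact fun i j hij => (hN i j).trans (hoffdiag _ _ (e.injective.ne (Sum.inl_injective.ne hij)))
  · exact fun i hi => (hN i i).trans (hdiag0 _ ((he_inl i).trans hi))
  · exact fun i hi => (hN i i).trans (hdiag1 _ (by rwa [he_inl]))
end

section
/- Let F be an algebraically closed field of characteristic p > 0, let k ≥ 1, and set n = p^k. Then: (a) there exists an n × n matrix over F[x_1, ..., x_n] whose entries are polynomials of degree at most 1 with determinant equal to ∑_{i=1}^n x_i^n (for instance the diagonal matrix with every diagonal entry equal to x_1 + ... + x_n works, since ∑_{i=1}^{p^k} x_i^{p^k} = (∑_{i=1}^{p^k} x_i)^{p^k} in characteristic p); and (b) every m × m matrix over F[x_1, ..., x_n] with entries of degree at most 1 and determinant equal to ∑_{i=1}^n x_i^n satisfies m ≥ n. Hence the determinantal complexity of ∑_{i=1}^n x_i^n over F is exactly n. -/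
open MvPolynomial

/-- The determinant of a matrix of polynomials of degree at most `1` has degree at most the
size of the matrix. -/
theorem totalDegree_det_le_card {σ ι R : Type*} [CommRing R] [Fintype ι] [DecidableEq ι]
    (M : Matrix ι ι (MvPolynomial σ R)) (hM : ∀ i j, (M i j).totalDegree ≤ 1) :
    M.det.totalDegree ≤ Fintype.card ι := by
  rw [Matrix.det_apply]
  refine totalDegree_finsetSum_le fun g _ => ?_
  refine (totalDegree_smul_le _ _).trans ?_
  refine (totalDegree_finsetProd _ _).trans ?_
  exact (Finset.sum_le_sum fun i _ => hM (g i) i).trans (by simp)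

/-- The `n`-th power sum in a nonempty set of variables has degree at least `n`. -/
theorem le_totalDegree_sum_X_pow {σ R : Type*} [CommSemiring R] [Nontrivial R] [Fintype σ]
    (i : σ) (n : ℕ) (hn : n ≠ 0) :
    n ≤ (∑ j : σ, (X j ^ n : MvPolynomial σ R)).totalDegree := by
  classical
  have hc : coeff (Finsupp.single i n) (∑ j : σ, (X j ^ n : MvPolynomial σ R)) = 1 := by
    simp [coeff_sum, X_pow_eq_monomial, coeff_monomial, Finsupp.single_left_inj hn]
  have h := le_totalDegree (mem_support_iff.mpr (hc ▸ one_ne_zero))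
  simpa using h

/-- Over an algebraically closed field `F` of characteristic `p > 0`,
for `n = p^k` with `k ≥ 1`:
(a) there is an `n × n` matrix of polynomials of degree at most 1 with determinant
`∑_{i=1}^n x_i^n` (e.g. the diagonal matrix with all diagonal entries `x_1 + ⋯ + x_n`,
by the Frobenius identity); and
(b) every `m × m` matrix of polynomials of degree at most 1 with determinant
`∑_{i=1}^n x_i^n` satisfies `m ≥ n`.
Hence the determinantal complexity of `∑_{i=1}^n x_i^n` over `F` is exactly `n`. -/
theorem dc_power_sum_char_p_exact
    (F : Type*) [Field F] [IsAlgClosed F] (p : ℕ) (hp : p.Prime) [CharP F p]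
    (k : ℕ) (hk : 1 ≤ k) (n : ℕ) (hn : n = p ^ k) :
    (∃ M : Matrix (Fin n) (Fin n) (MvPolynomial (Fin n) F),
        (∀ i j, (M i j).totalDegree ≤ 1) ∧ M.det = ∑ i : Fin n, X i ^ n) ∧
    (∀ (m : ℕ) (M : Matrix (Fin m) (Fin m) (MvPolynomial (Fin n) F)),
        (∀ i j, (M i j).totalDegree ≤ 1) → M.det = ∑ i : Fin n, X i ^ n → m ≥ n) := by
  have : Fact p.Prime := ⟨hp⟩
  have hpos : 0 < n := hn ▸ pow_pos hp.pos k
  refine ⟨⟨Matrix.diagonal fun _ => ∑ i, X i, fun i j => ?_, ?_⟩, fun m M hM hdet => ?_⟩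
  · rw [Matrix.diagonal_apply]
    split_ifs
    · exact totalDegree_finsetSum_le fun i _ => (totalDegree_X i).le
    · simp
  · rw [Matrix.det_diagonal, Finset.prod_const, Finset.card_univ, Fintype.card_fin]
    have h := sum_pow_char_pow (R := MvPolynomial (Fin n) F) p k Finset.univ
      (fun i : Fin n => X i)
    rwa [← hn] at h
  · have h := totalDegree_det_le_card M hM
    rw [hdet, Fintype.card_fin] at h
    exact (le_totalDegree_sum_X_pow ⟨0, hpos⟩ n hpos.ne').trans h
end
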